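/- arXiv:1801.07283 — 5 statements merged into one kernel-verified Lean document; each statement's English description precedes it below -/
import Mathlib

section
/- Iterated Beta-function Mellin convolution: let n ≥ 1 be a natural number, let δ₁, …, δₙ, A be complex numbers, and let σ₂, …, σₙ be real numbers such that σₖ > 0 and Re δₖ > σₖ for every 2 ≤ k ≤ n, and such that 0 < Re A − (σ₂ + ⋯ + σₙ) < Re δ₁. Then, setting τₖ = σₖ + i·tₖ for 2 ≤ k ≤ n and τ₁ = A − (τ₂ + ⋯ + τₙ), one has (1/(2π))^{n−1} ∫_{ℝ^{n−1}} ∏_{k=1}^{n} [Γ(τₖ)·Γ(δₖ − τₖ)/Γ(δₖ)] dt₂⋯dtₙ = Γ(A)·Γ(δ₁ + ⋯ + δₙ − A)/Γ(δ₁ + ⋯ + δₙ). In words: a product of n Beta-type factors whose Mellin variables satisfy the single linear constraint τ₁ + ⋯ + τₙ = A integrates to a single Beta-type factor in which all the δ's accumulate. -/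
open MeasureTheory

local notation "Γ" => Complex.Gamma

/-- The kernel `(1 + x)⁻¹ ^ δ`. -/
noncomputable def bker (δ : ℂ) (x : ℝ) : ℂ := (((1 + x)⁻¹ : ℝ) : ℂ) ^ δ

theorem bker_mul (a b : ℂ) {x : ℝ} (hx : 0 < x) : bker a x * bker b x = bker (a + b) x := by
  unfold bker
  rw [Complex.cpow_add]
  exact_mod_cast (by positivity : (1 + x)⁻¹ ≠ 0)

theorem bker_subst (s δ : ℂ) {x : ℝ} (hx : 0 < x) :
    |1 / (1 + x) ^ 2| • ((((x / (1 + x) : ℝ)) : ℂ) ^ (s - 1) *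
      (1 - ((x / (1 + x) : ℝ) : ℂ)) ^ (δ - s - 1)) = (x : ℂ) ^ (s - 1) • bker δ x := by
  have hy : 0 < (1 + x)⁻¹ := by positivity
  have h1 : (1 - ((x / (1 + x) : ℝ) : ℂ)) = (((1 + x)⁻¹ : ℝ) : ℂ) := by
    rw [← Complex.ofReal_one, ← Complex.ofReal_sub]
    congr 1
    field_simp
    ring
  have h2 : |1 / (1 + x) ^ 2| = ((1 + x)⁻¹) ^ 2 := by
    rw [abs_of_pos (by positivity)]; field_simp
  rw [h1, h2, div_eq_mul_inv, Complex.ofReal_mul, Complex.mul_cpow_ofReal_nonneg hx.le hy.le, bker]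
  set y : ℝ := (1 + x)⁻¹
  have hy0 : (y : ℂ) ≠ 0 := by exact_mod_cast hy.ne'
  have : (y : ℂ) ^ δ = (y : ℂ) ^ 2 * (y : ℂ) ^ (s - 1) * (y : ℂ) ^ (δ - s - 1) := by
    rw [← Complex.cpow_ofNat, ← Complex.cpow_add _ _ hy0, ← Complex.cpow_add _ _ hy0]
    congr 1
    ring
  rw [this, Complex.real_smul, smul_eq_mul]
  push_cast
  ring

theorem image_subst : Set.image (fun x : ℝ => x / (1 + x)) (Set.Ioi 0) = Set.Ioo 0 1 := by
  ext y
  constructor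
  · rintro ⟨x, hx, rfl⟩
    have hx : 0 < x := hx
    refine ⟨by positivity, ?_⟩
    simp only
    rw [div_lt_one (by positivity)]; linarith
  · rintro ⟨h0, h1⟩
    have : 0 < 1 - y := by linarith
    refine ⟨y / (1 - y), by simp only [Set.mem_Ioi]; positivity, ?_⟩
    simp only
    field_simp
    ring

theorem deriv_subst : ∀ x ∈ Set.Ioi (0 : ℝ),
    HasDerivWithinAt (fun x : ℝ => x / (1 + x)) (1 / (1 + x) ^ 2) (Set.Ioi 0) x := by
  intro x hx
  have hx : 0 < x := hx
  have := ((hasDerivAt_id x).div ((hasDerivAt_id x).const_add 1) (show (1 : ℝ) + x ≠ 0 by positivity))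
  refine HasDerivAt.hasDerivWithinAt ?_
  refine HasDerivAt.congr_deriv (f := fun x : ℝ => x / (1 + x)) this ?_
  change (1 * (1 + x) - x * 1) / (1 + x) ^ 2 = _
  ring

theorem inj_subst : Set.InjOn (fun x : ℝ => x / (1 + x)) (Set.Ioi 0) := by
  intro x hx y hy h
  have hx : 0 < x := hx
  have hy : 0 < y := hy
  simp only at h
  rw [div_eq_div_iff (by positivity) (by positivity)] at h
  linarith

theorem mellinConvergent_bker {s δ : ℂ} (h0 : 0 < s.re) (h1 : s.re < δ.re) :
    MellinConvergent (bker δ) s := by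
  have h := Complex.betaIntegral_convergent (u := s) (v := δ - s) h0 (by simpa using h1)
  rw [intervalIntegrable_iff_integrableOn_Ioo_of_le zero_le_one, ← image_subst,
    integrableOn_image_iff_integrableOn_abs_deriv_smul measurableSet_Ioi deriv_subst
      inj_subst] at h
  exact h.congr_fun (fun x hx => bker_subst s δ hx) measurableSet_Ioi

theorem mellin_bker {s δ : ℂ} (h0 : 0 < s.re) (h1 : s.re < δ.re) :
    mellin (bker δ) s = Γ s * Γ (δ - s) / Γ δ := by
  have h := Complex.betaIntegral_eq_Gamma_mul_div s (δ - s) h0 (by simpa using h1)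
  rw [add_sub_cancel] at h
  rw [← h, Complex.betaIntegral, intervalIntegral.integral_of_le zero_le_one,
    integral_Ioc_eq_integral_Ioo, ← image_subst,
    integral_image_eq_integral_abs_deriv_smul measurableSet_Ioi deriv_subst inj_subst, mellin]
  exact (setIntegral_congr_fun measurableSet_Ioi (fun x hx => bker_subst s δ hx)).symm

theorem norm_Gamma_le' {s : ℂ} (hs : 0 < s.re) : ‖Γ s‖ ≤ Real.Gamma s.re := by
  rw [Complex.Gamma_eq_integral hs, Complex.GammaIntegral, Real.Gamma_eq_integral hs]
  refine (norm_integral_le_integral_norm _).trans (le_of_eq ?_)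
  refine setIntegral_congr_fun measurableSet_Ioi (fun x hx => ?_)
  have hx : 0 < x := hx
  simp only [norm_mul, Complex.norm_cpow_eq_rpow_re_of_pos hx]
  simp [Complex.norm_exp]

/-- The Beta-type factor. -/
noncomputable def bfac (δ s : ℂ) : ℂ := Γ s * Γ (δ - s) / Γ δ

theorem norm_bfac_le {s δ : ℂ} (h0 : 0 < s.re) (h1 : s.re < δ.re) :
    ‖bfac δ s‖ ≤ Real.Gamma s.re * Real.Gamma (δ.re - s.re) / ‖Γ δ‖ := by
  unfold bfac
  rw [norm_div, norm_mul]
  have := norm_Gamma_le' (s := δ - s) (by simpa using h1)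
  rw [Complex.sub_re] at this
  have h3 := norm_Gamma_le' h0
  have := Real.Gamma_pos_of_pos h0
  gcongr

theorem norm_bfac_le_decay {s δ : ℂ} (h0 : 0 < s.re) (h1 : s.re < δ.re) :
    ‖bfac δ s‖ ≤ (Real.Gamma (s.re + 2) * Real.Gamma (δ.re - s.re) / ‖Γ δ‖) *
      (‖s‖ * ‖s + 1‖)⁻¹ := by
  have hs : s ≠ 0 := by rintro rfl; simp at h0
  have hs1 : s + 1 ≠ 0 := by
    intro h
    have := congrArg Complex.re h
    simp at this; linarith
  have hG : Γ s = Γ (s + 2) / (s * (s + 1)) := by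
    have e1 := Complex.Gamma_add_one s hs
    have e2 := Complex.Gamma_add_one (s + 1) hs1
    rw [show s + 2 = s + 1 + 1 by ring, e2, e1]
    field_simp
  unfold bfac
  rw [norm_div, norm_mul, hG, norm_div, norm_mul]
  have := norm_Gamma_le' (s := δ - s) (by simpa using h1)
  rw [Complex.sub_re] at this
  have h3 := norm_Gamma_le' (s := s + 2) (by simp; linarith)
  rw [Complex.add_re, Complex.re_ofNat] at h3
  have := Real.Gamma_pos_of_pos (show 0 < s.re + 2 by linarith)
  calc _ = ‖Γ (s + 2)‖ * ‖Γ (δ - s)‖ / ‖Γ δ‖ * (‖s‖ * ‖s + 1‖)⁻¹ := by ring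
    _ ≤ _ := by gcongr

theorem continuousAt_Gamma {s : ℂ} (h : 0 < s.re) : ContinuousAt Γ s := by
  refine (Complex.differentiableAt_Gamma _ (fun m hm => ?_)).continuousAt
  rw [hm] at h
  simp at h
  have : (0 : ℝ) ≤ m := m.cast_nonneg
  linarith

/-- continuity of a Beta-type factor along a continuous path in the strip -/
theorem continuous_bfac {X : Type*} [TopologicalSpace X] {δ : ℂ} {f : X → ℂ} (hf : Continuous f)
    (h0 : ∀ x, 0 < (f x).re) (h1 : ∀ x, (f x).re < δ.re) :
    Continuous (fun x => bfac δ (f x)) := by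
  unfold bfac
  rw [continuous_iff_continuousAt]
  intro x
  refine ContinuousAt.div_const (ContinuousAt.mul ?_ ?_) _
  · exact ContinuousAt.comp (f := f) (continuousAt_Gamma (h0 x)) hf.continuousAt
  · exact ContinuousAt.comp (f := fun x => δ - f x)
      (continuousAt_Gamma (by simpa using h1 x)) (by fun_prop)

theorem integrable_bfac {δ : ℂ} {σ : ℝ} (h0 : 0 < σ) (h1 : σ < δ.re) :
    Integrable (fun t : ℝ => bfac δ ((σ : ℂ) + (t : ℂ) * Complex.I)) := by
  have hre : ∀ t : ℝ, ((σ : ℂ) + (t : ℂ) * Complex.I).re = σ := by simp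
  have hc : Continuous (fun t : ℝ => bfac δ ((σ : ℂ) + (t : ℂ) * Complex.I)) :=
    continuous_bfac (by fun_prop) (by simpa using h0) (by simpa using h1)
  set C := Real.Gamma (σ + 2) * Real.Gamma (δ.re - σ) / ‖Γ δ‖
  have hC : 0 ≤ C := by
    have := Real.Gamma_pos_of_pos (show 0 < σ + 2 by linarith)
    have := Real.Gamma_pos_of_pos (show 0 < δ.re - σ by linarith)
    positivity
  set c : ℝ := min (σ ^ 2) 1
  have hc0 : 0 < c := by positivity
  refine Integrable.mono' ((integrable_inv_one_add_sq.const_mul (C * c⁻¹)))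
    hc.aestronglyMeasurable (Filter.Eventually.of_forall fun t => ?_)
  have hb := norm_bfac_le_decay (s := (σ : ℂ) + (t : ℂ) * Complex.I) (δ := δ)
    (by simpa using h0) (by simpa using h1)
  rw [hre] at hb
  refine hb.trans ?_
  rw [mul_assoc, ← mul_inv]
  refine mul_le_mul_of_nonneg_left ?_ hC
  refine inv_anti₀ (by positivity) ?_
  set s := (σ : ℂ) + (t : ℂ) * Complex.I
  have hsq : ‖s‖ ^ 2 = σ ^ 2 + t ^ 2 := by
    rw [← Complex.normSq_eq_norm_sq, Complex.normSq_apply]; simp [s]; ring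
  have hsq1 : ‖s + 1‖ ^ 2 = (σ + 1) ^ 2 + t ^ 2 := by
    rw [← Complex.normSq_eq_norm_sq, Complex.normSq_apply]; simp [s]; ring
  have hle : ‖s‖ ≤ ‖s + 1‖ := by
    refine le_of_sq_le_sq ?_ (norm_nonneg _)
    rw [hsq, hsq1]; nlinarith
  calc c * (1 + t ^ 2) = c + c * t ^ 2 := by ring
    _ ≤ σ ^ 2 + 1 * t ^ 2 := by
        gcongr
        · exact min_le_left _ _
        · exact min_le_right _ _
    _ = ‖s‖ * ‖s‖ := by rw [← sq, hsq]; ring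
    _ ≤ _ := by gcongr

/-- Barnes' first lemma in the Mellin-Parseval form. -/
theorem barnes_bfac {δ₀ δ A : ℂ} {σ : ℝ} (h0 : 0 < σ) (h1 : σ < δ.re)
    (h2 : 0 < A.re - σ) (h3 : A.re - σ < δ₀.re) :
    (∫ t : ℝ, bfac δ₀ (A - ((σ : ℂ) + (t : ℂ) * Complex.I)) *
      bfac δ ((σ : ℂ) + (t : ℂ) * Complex.I)) = 2 * (Real.pi : ℂ) * bfac (δ₀ + δ) A := by
  have hint := integrable_bfac h0 h1
  have hconv : IntegrableOn (fun x : ℝ => (x : ℂ) ^ (A - σ - 1) • bker δ₀ x) (Set.Ioi 0) :=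
    mellinConvergent_bker (s := A - σ) (by simpa using h2) (by simpa using h3)
  have hmel : ∀ t : ℝ, mellin (bker δ) ((σ : ℂ) + (t : ℂ) * Complex.I) =
      bfac δ ((σ : ℂ) + (t : ℂ) * Complex.I) := fun t =>
    mellin_bker (by simpa using h0) (by simpa using h1)
  have hinv : ∀ x : ℝ, 0 < x → (∫ t : ℝ, (x : ℂ) ^ (-((σ : ℂ) + (t : ℂ) * Complex.I)) *
      bfac δ ((σ : ℂ) + (t : ℂ) * Complex.I)) = 2 * (Real.pi : ℂ) * bker δ x := by
    intro x hx
    have hm := mellinInv_mellin_eq σ (bker δ) hx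
      (mellinConvergent_bker (by simpa using h0) (by simpa using h1))
      (by
        unfold Complex.VerticalIntegrable
        simpa only [hmel] using hint)
      (by
        unfold bker
        refine ContinuousAt.cpow ?_ (by fun_prop) ?_
        · exact Complex.continuous_ofReal.continuousAt.comp
            (ContinuousAt.inv₀ (by fun_prop) (by positivity))
        · exact Complex.ofReal_mem_slitPlane.2 (by positivity))
    rw [mellinInv] at hm
    simp only [hmel, smul_eq_mul, Complex.real_smul] at hm
    rw [← hm, ← mul_assoc]
    push_cast
    rw [mul_one_div_cancel (by simp), one_mul]
  have hF : Integrable (fun p : ℝ × ℝ => (p.2 : ℂ) ^ (-((p.1 : ℂ) * Complex.I)) *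
      (bfac δ ((σ : ℂ) + (p.1 : ℂ) * Complex.I) * ((p.2 : ℂ) ^ (A - σ - 1) • bker δ₀ p.2)))
      (volume.prod (volume.restrict (Set.Ioi 0))) := by
    refine (hint.mul_prod hconv).bdd_mul (c := 1) ?_ ?_
    · refine Measurable.aestronglyMeasurable ?_
      fun_prop
    · have : ∀ᵐ p : ℝ × ℝ ∂(volume.prod (volume.restrict (Set.Ioi 0))), p.2 ∈ Set.Ioi (0 : ℝ) :=
        Measure.quasiMeasurePreserving_snd.ae (ae_restrict_mem measurableSet_Ioi)
      filter_upwards [this] with p hp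
      rw [Complex.norm_cpow_eq_rpow_re_of_pos hp]
      simp
  have hsw := integral_integral_swap (f := fun t x : ℝ => (x : ℂ) ^ (-((t : ℂ) * Complex.I)) *
      (bfac δ ((σ : ℂ) + (t : ℂ) * Complex.I) * ((x : ℂ) ^ (A - σ - 1) • bker δ₀ x))) hF
  have hL : ∀ t : ℝ, (∫ x in Set.Ioi (0 : ℝ), (x : ℂ) ^ (-((t : ℂ) * Complex.I)) *
      (bfac δ ((σ : ℂ) + (t : ℂ) * Complex.I) * ((x : ℂ) ^ (A - σ - 1) • bker δ₀ x))) =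
      bfac δ₀ (A - ((σ : ℂ) + (t : ℂ) * Complex.I)) *
      bfac δ ((σ : ℂ) + (t : ℂ) * Complex.I) := by
    intro t
    have := mellin_bker (δ := δ₀) (s := A - ((σ : ℂ) + (t : ℂ) * Complex.I))
      (by simpa using h2) (by simpa using h3)
    rw [bfac.eq_1 δ₀, ← this, mellin, ← integral_mul_const]
    refine setIntegral_congr_fun measurableSet_Ioi (fun x hx => ?_)
    have hx0 : (x : ℂ) ≠ 0 := by exact_mod_cast (ne_of_gt hx)
    simp only [smul_eq_mul]
    rw [show A - ((σ : ℂ) + (t : ℂ) * Complex.I) - 1 = -((t : ℂ) * Complex.I) + (A - σ - 1) by ring,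
      Complex.cpow_add _ _ hx0]
    ring
  have hR : ∀ x ∈ Set.Ioi (0 : ℝ), (∫ t : ℝ, (x : ℂ) ^ (-((t : ℂ) * Complex.I)) *
      (bfac δ ((σ : ℂ) + (t : ℂ) * Complex.I) * ((x : ℂ) ^ (A - σ - 1) • bker δ₀ x))) =
      2 * (Real.pi : ℂ) * ((x : ℂ) ^ (A - 1) • bker (δ₀ + δ) x) := by
    intro x hx
    have hx0 : (x : ℂ) ≠ 0 := by exact_mod_cast (ne_of_gt hx)
    have e : 2 * (Real.pi : ℂ) * ((x : ℂ) ^ (A - 1) • bker (δ₀ + δ) x) =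
        (2 * (Real.pi : ℂ) * bker δ x) * ((x : ℂ) ^ (A - 1) * bker δ₀ x) := by
      rw [← bker_mul _ _ hx, smul_eq_mul]; ring
    rw [e, ← hinv x hx, ← integral_mul_const]
    congr 1
    ext t
    rw [show A - σ - 1 = (A - 1) + -(σ : ℂ) by ring, neg_add, Complex.cpow_add _ _ hx0,
      Complex.cpow_add _ _ hx0, smul_eq_mul]
    ring
  simp only [hL] at hsw
  rw [hsw, setIntegral_congr_fun measurableSet_Ioi hR, integral_const_mul]
  congr 1
  refine mellin_bker ?_ ?_
  · linarith
  · rw [Complex.add_re]; linarith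

theorem iterated_bfac (m : ℕ) : ∀ (δ₀ A : ℂ) (δ : Fin m → ℂ) (σ : Fin m → ℝ)
    (_ : ∀ k, 0 < σ k) (_ : ∀ k, σ k < (δ k).re)
    (_ : 0 < A.re - ∑ k, σ k) (_ : A.re - ∑ k, σ k < δ₀.re),
    (∫ t : Fin m → ℝ,
        bfac δ₀ (A - ∑ k, ((σ k : ℂ) + (t k : ℂ) * Complex.I)) *
          ∏ k, bfac (δ k) ((σ k : ℂ) + (t k : ℂ) * Complex.I)) =
      (2 * (Real.pi : ℂ)) ^ m * bfac (δ₀ + ∑ k, δ k) A := by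
  induction m with
  | zero =>
    intro δ₀ A δ σ _ _ _ _
    rw [volume_pi, Measure.pi_of_empty _ finZeroElim, integral_dirac]
    simp
  | succ m ih =>
    intro δ₀ A δ σ hσ hδ h1 h2
    have hre : ∀ t : Fin (m + 1) → ℝ,
        (A - ∑ k, ((σ k : ℂ) + (t k : ℂ) * Complex.I)).re = A.re - ∑ k, σ k := by
      intro t
      simp
    have hInt : Integrable (fun t : Fin (m + 1) → ℝ =>
        bfac δ₀ (A - ∑ k, ((σ k : ℂ) + (t k : ℂ) * Complex.I)) *
          ∏ k, bfac (δ k) ((σ k : ℂ) + (t k : ℂ) * Complex.I)) := by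
      have hp : Integrable (fun t : Fin (m + 1) → ℝ =>
          ∏ k, bfac (δ k) ((σ k : ℂ) + (t k : ℂ) * Complex.I)) :=
        Integrable.fintype_prod (f := fun k (x : ℝ) => bfac (δ k) ((σ k : ℂ) + (x : ℂ) * Complex.I))
          (fun k => integrable_bfac (hσ k) (hδ k))
      refine hp.bdd_mul (Continuous.aestronglyMeasurable ?_) (Filter.Eventually.of_forall fun t => ?_)
        (c := Real.Gamma (A.re - ∑ k, σ k) * Real.Gamma (δ₀.re - (A.re - ∑ k, σ k)) / ‖Γ δ₀‖)
      · refine continuous_bfac (by fun_prop) (fun t => ?_) (fun t => ?_)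
        · rw [hre]; exact h1
        · rw [hre]; exact h2
      · have := norm_bfac_le (δ := δ₀) (s := A - ∑ k, ((σ k : ℂ) + (t k : ℂ) * Complex.I))
          (by rw [hre]; exact h1) (by rw [hre]; exact h2)
        rwa [hre] at this
    have mp := (volume_preserving_piFinSuccAbove (fun _ : Fin (m + 1) => ℝ) 0).symm
    rw [← mp.integral_comp (MeasurableEquiv.measurableEmbedding _)]
    have hInt' := (mp.integrable_comp_emb (MeasurableEquiv.measurableEmbedding _)).2 hInt
    rw [Measure.volume_eq_prod] at hInt' ⊢
    refine (integral_prod_symm _ hInt').trans ?_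
    have hsum : ∑ k, σ k = σ 0 + ∑ k : Fin m, σ k.succ := Fin.sum_univ_succ _
    have hpos : 0 ≤ ∑ k : Fin m, σ k.succ := Finset.sum_nonneg fun k _ => (hσ _).le
    have hinner : ∀ y : Fin m → ℝ, (∫ x : ℝ, (fun t : Fin (m + 1) → ℝ =>
        bfac δ₀ (A - ∑ k, ((σ k : ℂ) + (t k : ℂ) * Complex.I)) *
          ∏ k, bfac (δ k) ((σ k : ℂ) + (t k : ℂ) * Complex.I))
          ((MeasurableEquiv.piFinSuccAbove (fun _ : Fin (m + 1) => ℝ) 0).symm (x, y))) =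
        2 * (Real.pi : ℂ) * (bfac (δ₀ + δ 0)
          (A - ∑ k : Fin m, ((σ k.succ : ℂ) + (y k : ℂ) * Complex.I)) *
          ∏ k : Fin m, bfac (δ k.succ) ((σ k.succ : ℂ) + (y k : ℂ) * Complex.I)) := by
      intro y
      have hre' : (A - ∑ k : Fin m, ((σ k.succ : ℂ) + (y k : ℂ) * Complex.I)).re =
          A.re - ∑ k : Fin m, σ k.succ := by simp
      have hb := barnes_bfac (δ₀ := δ₀) (δ := δ 0) (σ := σ 0)
        (A := A - ∑ k : Fin m, ((σ k.succ : ℂ) + (y k : ℂ) * Complex.I)) (hσ 0) (hδ 0)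
        (by rw [hre']; linarith) (by rw [hre']; linarith)
      rw [← mul_assoc, ← hb, ← integral_mul_const]
      congr 1
      ext x
      simp only [MeasurableEquiv.piFinSuccAbove_symm_apply, Fin.insertNthEquiv_apply,
        Fin.insertNth_zero', Fin.sum_univ_succ, Fin.prod_univ_succ, Fin.cons_zero, Fin.cons_succ]
      rw [← mul_assoc]
      congr 3
      ring
    have hfin := ih (δ₀ + δ 0) A (fun k => δ k.succ) (fun k => σ k.succ) (fun k => hσ _)
      (fun k => hδ _) (by have := hσ 0; linarith)
      (by have := hδ 0; rw [Complex.add_re]; linarith)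
    refine (integral_congr_ae (Filter.Eventually.of_forall hinner)).trans ?_
    rw [integral_const_mul, hfin, Fin.sum_univ_succ, pow_succ, add_assoc]
    ring

/-- **Iterated Beta-function Mellin convolution.**  Here `n = m + 1 ≥ 1` is the number of
Beta-type factors; `δ₀`, and `δ k`, `σ k` for `k : Fin m`, play the roles of `δ₁` and of
`δ_{k+2}`, `σ_{k+2}` in the natural-language statement.  Setting `τₖ = σₖ + i tₖ` for the
last `m` variables and `τ₁ = A − (τ₂ + ⋯ + τₙ)`, the `(n−1)`-fold Mellin–Barnes integral of
the product of Beta-type factors collapses to a single Beta-type factor in which all the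
`δ`'s accumulate. -/
theorem iterated_beta_mellin_convolution
    (m : ℕ) (δ₀ A : ℂ) (δ : Fin m → ℂ) (σ : Fin m → ℝ)
    (hσpos : ∀ k, 0 < σ k)
    (hσδ : ∀ k, σ k < (δ k).re)
    (hA₁ : 0 < A.re - ∑ k, σ k)
    (hA₂ : A.re - ∑ k, σ k < δ₀.re) :
    (1 / (2 * (Real.pi : ℂ))) ^ m *
      (∫ t : Fin m → ℝ,
        (Γ (A - ∑ k, ((σ k : ℂ) + (t k : ℂ) * Complex.I)) *
            Γ (δ₀ - (A - ∑ k, ((σ k : ℂ) + (t k : ℂ) * Complex.I))) / Γ δ₀) *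
          ∏ k, (Γ ((σ k : ℂ) + (t k : ℂ) * Complex.I) *
            Γ (δ k - ((σ k : ℂ) + (t k : ℂ) * Complex.I)) / Γ (δ k))) =
      Γ A * Γ (δ₀ + (∑ k, δ k) - A) / Γ (δ₀ + ∑ k, δ k) := by
  have h := iterated_bfac m δ₀ A δ σ hσpos hσδ hA₁ hA₂
  unfold bfac at h
  rw [h]
  rw [← mul_assoc, ← mul_pow, one_div_mul_cancel (by simp), one_pow, one_mul]
end

section
/- Let a₁, a₂, b₁, b₂, c₁, c₂ be complex numbers and σₓ, σᵧ real numbers satisfying Re a₁ + σₓ > 0, Re a₂ − σₓ > 0, Re b₁ + σₓ − σᵧ > 0, Re b₂ − σₓ + σᵧ > 0, Re c₁ + σᵧ > 0 and Re c₂ − σᵧ > 0. Then, writing x = σₓ + i·s and y = σᵧ + i·t, one has (1/(2π))² ∫_{ℝ²} Γ(a₁+x)·Γ(a₂−x)·Γ(b₁+x−y)·Γ(b₂−x+y)·Γ(c₁+y)·Γ(c₂−y) ds dt = Γ(a₁+a₂)·Γ(b₁+b₂)·Γ(c₁+c₂)·Γ(a₁+b₂+c₂)·Γ(a₂+b₁+c₁)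 / Γ(a₁+a₂+b₁+b₂+c₁+c₂). -/
open MeasureTheory

local notation "Γ" => Complex.Gamma

lemma norm_Gamma_le_re {z : ℂ} (hz : 0 < z.re) : ‖Γ z‖ ≤ Real.Gamma z.re := by
  rw [Complex.Gamma_eq_integral hz, Real.Gamma_eq_integral hz, Complex.GammaIntegral]
  refine (norm_integral_le_integral_norm _).trans (le_of_eq ?_)
  refine setIntegral_congr_fun measurableSet_Ioi fun x hx => ?_
  have hx' : (0 : ℝ) < x := hx
  simp only [norm_mul, Complex.norm_real, Complex.norm_cpow_eq_rpow_re_of_pos hx', Complex.sub_re,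
    Complex.one_re, Real.norm_eq_abs, abs_of_pos (Real.exp_pos _)]

lemma norm_Gamma_decay {z : ℂ} (hz : 0 < z.re) :
    ‖Γ z‖ ≤ Real.Gamma (z.re + 2) * (z.re ^ 2 + z.im ^ 2)⁻¹ := by
  have h0 : z ≠ 0 := by rintro rfl; simp at hz
  have h1 : z + 1 ≠ 0 := by
    intro h
    have := congrArg Complex.re h
    simp at this; linarith
  have e : Γ (z + 2) = (z + 1) * (z * Γ z) := by
    rw [← Complex.Gamma_add_one z h0, ← Complex.Gamma_add_one _ h1]; congr 1; ring
  have hb := norm_Gamma_le_re (z := z + 2) (by simp; linarith)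
  rw [e, norm_mul, norm_mul] at hb
  have hs : z.re ^ 2 + z.im ^ 2 = ‖z‖ ^ 2 := by
    rw [← Complex.normSq_eq_norm_sq, Complex.normSq_apply]; ring
  have hn : 0 < ‖z‖ := norm_pos_iff.2 h0
  have hle : ‖z‖ ≤ ‖z + 1‖ := by
    rw [← sq_le_sq₀ (norm_nonneg _) (norm_nonneg _), ← Complex.normSq_eq_norm_sq,
      ← Complex.normSq_eq_norm_sq, Complex.normSq_apply, Complex.normSq_apply]
    simp; nlinarith
  rw [hs, ← div_eq_mul_inv, le_div_iff₀ (by positivity)]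
  have e2 : (z + 2).re = z.re + 2 := by simp
  rw [e2] at hb
  refine le_trans ?_ hb
  have : 0 ≤ ‖Γ z‖ := norm_nonneg _
  calc ‖Γ z‖ * ‖z‖ ^ 2 = ‖z‖ * (‖z‖ * ‖Γ z‖) := by ring
    _ ≤ _ := by gcongr

lemma continuous_Gamma_comp {X : Type*} [TopologicalSpace X] {f : X → ℂ} (hf : Continuous f)
    (h : ∀ x, 0 < (f x).re) : Continuous fun x => Γ (f x) := by
  rw [continuous_iff_continuousAt]
  intro x
  refine ContinuousAt.comp (f := f) (g := Γ) ?_ hf.continuousAt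
  refine (Complex.differentiableAt_Gamma _ fun m hm => ?_).continuousAt
  have := h x
  rw [hm] at this
  simp at this
  linarith [Nat.cast_nonneg (α := ℝ) m]

lemma integrable_Gamma {a : ℂ} (ha : 0 < a.re) :
    Integrable fun s : ℝ => Γ (a + s * Complex.I) := by
  have h : Integrable fun s : ℝ => Γ (a.re + s * Complex.I) := by
    have hc : Continuous fun s : ℝ => Γ (a.re + s * Complex.I) :=
      continuous_Gamma_comp (by fun_prop) (by simpa using ha)
    refine Integrable.mono' (integrable_inv_one_add_sq.const_mul
      (Real.Gamma (a.re + 2) * (min (a.re ^ 2) 1)⁻¹)) hc.aestronglyMeasurable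
      (Filter.Eventually.of_forall fun s => ?_)
    have := norm_Gamma_decay (z := a.re + s * Complex.I) (by simpa using ha)
    simp at this
    refine this.trans ?_
    have hm : 0 < min (a.re ^ 2) 1 := by positivity
    rw [mul_assoc, ← mul_inv]
    have hg : 0 < Real.Gamma (a.re + 2) := Real.Gamma_pos_of_pos (by linarith)
    gcongr
    nlinarith [min_le_left (a.re ^ 2) 1, min_le_right (a.re ^ 2) 1, sq_nonneg s]
  convert h.comp_add_right a.im using 2 with s
  congr 1
  apply Complex.ext <;> simp
  ring

/-- Beta density in the logistic coordinate. -/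
noncomputable def betaKer (a b : ℂ) (u : ℝ) : ℂ :=
  Complex.exp (a * (Real.log (Real.sigmoid u) : ℝ) + b * (Real.log (Real.sigmoid (-u)) : ℝ))

lemma continuous_betaKer (a b : ℂ) : Continuous (betaKer a b) := by
  have h1 : Continuous fun u : ℝ => Real.log (Real.sigmoid u) :=
    continuous_sigmoid.log fun u => (Real.sigmoid_pos u).ne'
  have h2 : Continuous fun u : ℝ => Real.log (Real.sigmoid (-u)) :=
    (continuous_sigmoid.comp continuous_neg).log fun u => (Real.sigmoid_pos _).ne'
  unfold betaKer
  fun_prop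

lemma betaKer_mul (a b c d : ℂ) (u : ℝ) :
    betaKer a b u * betaKer c d (-u) = betaKer (a + d) (b + c) u := by
  simp only [betaKer, ← Complex.exp_add, neg_neg]
  congr 1; ring

lemma log_sigmoid_sub (u : ℝ) :
    Real.log (Real.sigmoid (-u)) = Real.log (Real.sigmoid u) - u := by
  rw [← Real.sigmoid_mul_rexp_neg, Real.log_mul (Real.sigmoid_pos u).ne' (Real.exp_pos _).ne',
    Real.log_exp]; ring

lemma betaKer_shift (a b : ℂ) (z : ℂ) (u : ℝ) :
    betaKer (a + z) (b - z) u = Complex.exp (u * z) * betaKer a b u := by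
  simp only [betaKer, ← Complex.exp_add, log_sigmoid_sub]
  congr 1; push_cast; ring

lemma betaKer_eq (a b : ℂ) (u : ℝ) :
    |Real.sigmoid u * (1 - Real.sigmoid u)| •
      ((Real.sigmoid u : ℂ) ^ (a - 1) * (1 - (Real.sigmoid u : ℂ)) ^ (b - 1)) = betaKer a b u := by
  have h1 := Real.sigmoid_pos u
  have h2 := Real.sigmoid_pos (-u)
  have h3 : (1 - (Real.sigmoid u : ℂ)) = ((Real.sigmoid (-u) : ℝ) : ℂ) := by
    rw [Real.sigmoid_neg]; push_cast; ring
  have h4 : ((Real.sigmoid u : ℝ) : ℂ) ≠ 0 := by exact_mod_cast h1.ne'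
  have h5 : ((Real.sigmoid (-u) : ℝ) : ℂ) ≠ 0 := by exact_mod_cast h2.ne'
  rw [h3, ← Real.sigmoid_neg, abs_of_pos (by positivity), Complex.real_smul,
    Complex.cpow_sub _ _ h4, Complex.cpow_sub _ _ h5, Complex.cpow_one, Complex.cpow_one,
    betaKer, Complex.exp_add, Complex.cpow_def_of_ne_zero h4, Complex.cpow_def_of_ne_zero h5,
    Complex.ofReal_log h1.le, Complex.ofReal_log h2.le]
  push_cast
  field_simp

lemma betaKer_integral {a b : ℂ} (ha : 0 < a.re) (hb : 0 < b.re) :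
    Integrable (betaKer a b) ∧ ∫ u, betaKer a b u = Γ a * Γ b / Γ (a + b) := by
  have hd : ∀ x ∈ Set.univ, HasDerivWithinAt Real.sigmoid
      (Real.sigmoid x * (1 - Real.sigmoid x)) Set.univ x :=
    fun x _ => (Real.hasDerivAt_sigmoid x).hasDerivWithinAt
  have him : Real.sigmoid '' Set.univ = Set.Ioo 0 1 := by
    rw [Set.image_univ, Real.range_sigmoid]
  constructor
  · have h := Complex.betaIntegral_convergent ha hb
    rw [intervalIntegrable_iff_integrableOn_Ioo_of_le zero_le_one, ← him,
      integrableOn_image_iff_integrableOn_abs_deriv_smul MeasurableSet.univ hd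
        Real.sigmoid_injective.injOn] at h
    simp only [betaKer_eq, integrableOn_univ] at h
    exact h
  · have hne : Γ (a + b) ≠ 0 := Complex.Gamma_ne_zero_of_re_pos (by simp; linarith)
    rw [Complex.Gamma_mul_Gamma_eq_betaIntegral ha hb, mul_div_cancel_left₀ _ hne,
      Complex.betaIntegral, intervalIntegral.integral_of_le zero_le_one,
      integral_Ioc_eq_integral_Ioo, ← him,
      integral_image_eq_integral_abs_deriv_smul MeasurableSet.univ hd Real.sigmoid_injective.injOn]
    simp only [betaKer_eq, setIntegral_univ]

open FourierTransform in
lemma fourier_betaKer {a b : ℂ} (ha : 0 < a.re) (hb : 0 < b.re) (w : ℝ) :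
    𝓕 (betaKer a b) w = Γ (a + ((-(2 * Real.pi) * w : ℝ) : ℂ) * Complex.I) *
      Γ (b - ((-(2 * Real.pi) * w : ℝ) : ℂ) * Complex.I) / Γ (a + b) := by
  have := (betaKer_integral (a := a + ((-(2 * Real.pi) * w : ℝ) : ℂ) * Complex.I)
    (b := b - ((-(2 * Real.pi) * w : ℝ) : ℂ) * Complex.I)
    (by simpa using ha) (by simpa using hb)).2
  rw [show a + ((-(2 * Real.pi) * w : ℝ) : ℂ) * Complex.I +
    (b - ((-(2 * Real.pi) * w : ℝ) : ℂ) * Complex.I) = a + b by ring] at this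
  rw [← this, Real.fourier_real_eq_integral_exp_smul]
  congr 1; ext u
  rw [betaKer_shift, smul_eq_mul]
  congr 2; push_cast; ring

/-- The four-Gamma integrand is bounded times integrable. -/
lemma continuous_Gamma_line {a : ℂ} (ha : 0 < a.re) :
    Continuous fun s : ℝ => Γ (a + s * Complex.I) :=
  continuous_Gamma_comp (by fun_prop) (by simpa using ha)

lemma continuous_Gamma_line' {a : ℂ} (ha : 0 < a.re) :
    Continuous fun s : ℝ => Γ (a - s * Complex.I) :=
  continuous_Gamma_comp (by fun_prop) (by simpa using ha)

lemma integrable_Gamma_two {a b : ℂ} (ha : 0 < a.re) (hb : 0 < b.re) :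
    Integrable fun s : ℝ => Γ (a + s * Complex.I) * Γ (b - s * Complex.I) := by
  refine (integrable_Gamma ha).mul_bdd (c := Real.Gamma b.re) 
    (continuous_Gamma_line' hb).aestronglyMeasurable (Filter.Eventually.of_forall fun s => ?_)
  have := norm_Gamma_le_re (z := b - s * Complex.I) (by simpa using hb)
  simpa using this

open FourierTransform in
/-- Barnes' first lemma. -/
lemma barnes_first {a b c d : ℂ} (ha : 0 < a.re) (hb : 0 < b.re) (hc : 0 < c.re) (hd : 0 < d.re) :
    ∫ s : ℝ, Γ (a + s * Complex.I) * Γ (b - s * Complex.I) *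
      (Γ (c + s * Complex.I) * Γ (d - s * Complex.I)) =
    2 * Real.pi * (Γ (a + b) * Γ (c + d) * Γ (a + d) * Γ (b + c) / Γ (a + b + c + d)) := by
  have hπ := Real.pi_pos
  have h1 := (betaKer_integral ha hb).1
  have h2 := (betaKer_integral hc hd).1
  have hF2 : Integrable (𝓕 (betaKer c d)) := by
    have : 𝓕 (betaKer c d) = fun w => _ := funext (fourier_betaKer hc hd)
    rw [this]
    exact ((integrable_Gamma_two hc hd).comp_mul_left' (neg_ne_zero.2 (by positivity))).div_const _
  have hinv : ∀ u, 𝓕 (𝓕 (betaKer c d)) u = betaKer c d (-u) := by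
    intro u
    rw [← (continuous_betaKer c d).fourierInv_fourier_eq h2 hF2, Real.fourierInv_eq_fourier_neg,
      neg_neg, (continuous_betaKer c d).fourierInv_fourier_eq h2 hF2]
  have hP : ∫ w, 𝓕 (betaKer a b) w • 𝓕 (betaKer c d) w =
      ∫ u, betaKer a b u • 𝓕 (𝓕 (betaKer c d)) u := by
    simpa using! (VectorFourier.integral_fourierIntegral_smul_eq_flip (L := innerₗ ℝ)
      Real.continuous_fourierChar continuous_inner h1 hF2)
  simp only [hinv, smul_eq_mul, betaKer_mul] at hP
  rw [(betaKer_integral (by simp; linarith) (by simp; linarith)).2] at hP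
  simp only [fourier_betaKer ha hb, fourier_betaKer hc hd] at hP
  rw [Measure.integral_comp_mul_left (fun s : ℝ => Γ (a + s * Complex.I) * Γ (b - s * Complex.I)
    / Γ (a + b) * (Γ (c + s * Complex.I) * Γ (d - s * Complex.I) / Γ (c + d)))] at hP
  have hab : Γ (a + b) ≠ 0 := Complex.Gamma_ne_zero_of_re_pos (by simp; linarith)
  have hcd : Γ (c + d) ≠ 0 := Complex.Gamma_ne_zero_of_re_pos (by simp; linarith)
  have e : ∀ s : ℝ, Γ (a + s * Complex.I) * Γ (b - s * Complex.I)
    / Γ (a + b) * (Γ (c + s * Complex.I) * Γ (d - s * Complex.I) / Γ (c + d)) =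
    (Γ (a + b) * Γ (c + d))⁻¹ * (Γ (a + s * Complex.I) * Γ (b - s * Complex.I) *
      (Γ (c + s * Complex.I) * Γ (d - s * Complex.I))) := by
    intro s; field_simp
  simp only [e] at hP
  rw [integral_const_mul, inv_neg, abs_neg, abs_of_pos (by positivity), Complex.real_smul,
    show a + d + (b + c) = a + b + c + d by ring] at hP
  have hpc : (Real.pi : ℂ) ≠ 0 := by exact_mod_cast hπ.ne'
  rw [mul_assoc (Γ (a + b) * Γ (c + d)), mul_div_assoc, ← hP]
  generalize (∫ s : ℝ, Γ (a + s * Complex.I) * Γ (b - s * Complex.I) *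
      (Γ (c + s * Complex.I) * Γ (d - s * Complex.I))) = J
  push_cast
  field_simp

/-- Two-fold Mellin–Barnes integral with six Gamma factors, evaluated by two successive
applications of Barnes' first lemma (the paper's eq. (C.14)).  Here `x = σₓ + i s` and
`y = σᵧ + i t` run along upward-oriented vertical contours. -/
theorem two_fold_mellin_barnes
    (a₁ a₂ b₁ b₂ c₁ c₂ : ℂ) (σx σy : ℝ)
    (h₁ : 0 < a₁.re + σx) (h₂ : 0 < a₂.re - σx)
    (h₃ : 0 < b₁.re + σx - σy) (h₄ : 0 < b₂.re - σx + σy)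
    (h₅ : 0 < c₁.re + σy) (h₆ : 0 < c₂.re - σy) :
    (1 / (2 * (Real.pi : ℂ))) ^ 2 *
      (∫ q : ℝ × ℝ,
        let x : ℂ := (σx : ℂ) + (q.1 : ℂ) * Complex.I
        let y : ℂ := (σy : ℂ) + (q.2 : ℂ) * Complex.I
        Γ (a₁ + x) * Γ (a₂ - x) * Γ (b₁ + x - y) * Γ (b₂ - x + y) *
          Γ (c₁ + y) * Γ (c₂ - y)) =
      Γ (a₁ + a₂) * Γ (b₁ + b₂) * Γ (c₁ + c₂) * Γ (a₁ + b₂ + c₂) * Γ (a₂ + b₁ + c₁) /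
        Γ (a₁ + a₂ + b₁ + b₂ + c₁ + c₂) := by
  have hint : Integrable (fun q : ℝ × ℝ =>
      (Γ ((a₁ + σx) + q.1 * Complex.I) * Γ ((c₁ + σy) + q.2 * Complex.I)) *
      ((Γ ((a₂ - σx) - q.1 * Complex.I) *
        Γ ((b₁ + σx - σy) + q.1 * Complex.I - q.2 * Complex.I)) *
      (Γ ((b₂ - σx + σy) - q.1 * Complex.I + q.2 * Complex.I) *
        Γ ((c₂ - σy) - q.2 * Complex.I)))) (volume.prod volume) := by
    refine ((integrable_Gamma (a := a₁ + σx) (by simpa using h₁)).mul_prod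
      (integrable_Gamma (a := c₁ + σy) (by simpa using h₅))).mul_bdd
      (c := (Real.Gamma (a₂.re - σx) * Real.Gamma (b₁.re + σx - σy)) *
        (Real.Gamma (b₂.re - σx + σy) * Real.Gamma (c₂.re - σy))) ?_ ?_
    · refine Continuous.aestronglyMeasurable ?_
      refine ((continuous_Gamma_comp (by fun_prop) ?_).mul
        (continuous_Gamma_comp (by fun_prop) ?_)).mul
        ((continuous_Gamma_comp (by fun_prop) ?_).mul (continuous_Gamma_comp (by fun_prop) ?_))
      · simpa using h₂
      · simpa using h₃
      · simpa using h₄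
      · simpa using h₆
    · refine Filter.Eventually.of_forall fun q => ?_
      rw [norm_mul, norm_mul, norm_mul]
      have k1 := norm_Gamma_le_re (z := (a₂ - σx) - q.1 * Complex.I) (by simpa using h₂)
      have k2 := norm_Gamma_le_re (z := (b₁ + σx - σy) + q.1 * Complex.I - q.2 * Complex.I)
        (by simpa using h₃)
      have k3 := norm_Gamma_le_re (z := (b₂ - σx + σy) - q.1 * Complex.I + q.2 * Complex.I)
        (by simpa using h₄)
      have k4 := norm_Gamma_le_re (z := (c₂ - σy) - q.2 * Complex.I) (by simpa using h₆)
      simp at k1 k2 k3 k4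
      have := (Real.Gamma_pos_of_pos h₂).le
      have := (Real.Gamma_pos_of_pos h₃).le
      have := (Real.Gamma_pos_of_pos h₄).le
      gcongr
  have hpc : (Real.pi : ℂ) ≠ 0 := by exact_mod_cast Real.pi_pos.ne'
  have hne : Γ (b₁ + b₂ + c₁ + c₂) ≠ 0 :=
    Complex.Gamma_ne_zero_of_re_pos (by simp; linarith)
  have step : (∫ q : ℝ × ℝ,
        let x : ℂ := (σx : ℂ) + (q.1 : ℂ) * Complex.I
        let y : ℂ := (σy : ℂ) + (q.2 : ℂ) * Complex.I
        Γ (a₁ + x) * Γ (a₂ - x) * Γ (b₁ + x - y) * Γ (b₂ - x + y) *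
          Γ (c₁ + y) * Γ (c₂ - y)) = ∫ s : ℝ, ∫ t : ℝ,
      (Γ ((a₁ + σx) + s * Complex.I) * Γ ((c₁ + σy) + t * Complex.I)) *
      ((Γ ((a₂ - σx) - s * Complex.I) *
        Γ ((b₁ + σx - σy) + s * Complex.I - t * Complex.I)) *
      (Γ ((b₂ - σx + σy) - s * Complex.I + t * Complex.I) *
        Γ ((c₂ - σy) - t * Complex.I))) := by
    rw [← integral_prod _ hint, ← Measure.volume_eq_prod]
    congr 1; ext q
    simp only []
    rw [show a₁ + (σx + q.1 * Complex.I) = (a₁ + σx) + q.1 * Complex.I by ring,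
      show a₂ - (σx + q.1 * Complex.I) = (a₂ - σx) - q.1 * Complex.I by ring,
      show b₁ + (σx + q.1 * Complex.I) - (σy + q.2 * Complex.I) =
        (b₁ + σx - σy) + q.1 * Complex.I - q.2 * Complex.I by ring,
      show b₂ - (σx + q.1 * Complex.I) + (σy + q.2 * Complex.I) =
        (b₂ - σx + σy) - q.1 * Complex.I + q.2 * Complex.I by ring,
      show c₁ + (σy + q.2 * Complex.I) = (c₁ + σy) + q.2 * Complex.I by ring,
      show c₂ - (σy + q.2 * Complex.I) = (c₂ - σy) - q.2 * Complex.I by ring]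
    ring
  have inner_eq : ∀ s : ℝ, (∫ t : ℝ,
      (Γ ((a₁ + σx) + s * Complex.I) * Γ ((c₁ + σy) + t * Complex.I)) *
      ((Γ ((a₂ - σx) - s * Complex.I) *
        Γ ((b₁ + σx - σy) + s * Complex.I - t * Complex.I)) *
      (Γ ((b₂ - σx + σy) - s * Complex.I + t * Complex.I) *
        Γ ((c₂ - σy) - t * Complex.I)))) =
      (2 * Real.pi * (Γ (b₁ + b₂) * Γ (c₁ + c₂) / Γ (b₁ + b₂ + c₁ + c₂))) *
      (Γ ((a₁ + σx) + s * Complex.I) * Γ ((a₂ - σx) - s * Complex.I) *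
        (Γ ((b₁ + c₁ + σx) + s * Complex.I) * Γ ((b₂ + c₂ - σx) - s * Complex.I))) := by
    intro s
    have hB := barnes_first (a := b₂ - σx + σy - s * Complex.I) (b := b₁ + σx - σy + s * Complex.I)
      (c := c₁ + σy) (d := c₂ - σy) (by simpa using h₄) (by simpa using h₃) (by simpa using h₅)
      (by simpa using h₆)
    rw [show b₂ - σx + σy - s * Complex.I + (b₁ + σx - σy + s * Complex.I) = b₁ + b₂ by ring,
      show c₁ + σy + (c₂ - σy) = c₁ + c₂ by ring,
      show b₂ - σx + σy - s * Complex.I + (c₂ - σy) = (b₂ + c₂ - σx) - s * Complex.I by ring,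
      show b₁ + σx - σy + s * Complex.I + (c₁ + σy) = (b₁ + c₁ + σx) + s * Complex.I by ring] at hB
    calc _ = ∫ t : ℝ, (Γ ((a₁ + σx) + s * Complex.I) * Γ ((a₂ - σx) - s * Complex.I)) *
          (Γ (b₂ - σx + σy - s * Complex.I + t * Complex.I) *
            Γ (b₁ + σx - σy + s * Complex.I - t * Complex.I) *
            (Γ (c₁ + σy + t * Complex.I) * Γ (c₂ - σy - t * Complex.I))) := by
          congr 1; ext t; ring
      _ = _ := by
          rw [integral_const_mul, hB]
          ring
  rw [step]
  simp only [inner_eq]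
  rw [integral_const_mul, barnes_first (by simpa using h₁) (by simpa using h₂)
    (by simp; linarith) (by simp; linarith)]
  rw [show a₁ + σx + (a₂ - σx) = a₁ + a₂ by ring,
    show b₁ + c₁ + σx + (b₂ + c₂ - σx) = b₁ + b₂ + c₁ + c₂ by ring,
    show a₁ + σx + (b₂ + c₂ - σx) = a₁ + b₂ + c₂ by ring,
    show a₂ - σx + (b₁ + c₁ + σx) = a₂ + b₁ + c₁ by ring,
    show a₁ + a₂ + (b₁ + c₁ + σx) + (b₂ + c₂ - σx) = a₁ + a₂ + b₁ + b₂ + c₁ + c₂ by ring]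
  field_simp
end

section
/- Let a₁, a₂, b₁, b₂, c₁, c₂, d be complex numbers and σₓ, σᵧ real numbers satisfying Re a₁ + σₓ > 0, Re a₂ − σₓ > 0, Re b₁ + σₓ − σᵧ > 0, Re b₂ − σₓ + σᵧ > 0, Re c₁ + σᵧ > 0, Re c₂ − σᵧ > 0 and Re d + σᵧ > 0. Then, writing x = σₓ + i·s and y = σᵧ + i·t, one has (1/(2π))² ∫_{ℝ²} [Γ(a₁+x)·Γ(a₂−x)·Γ(b₁+x−y)·Γ(b₂−x+y)·Γ(c₁+y)·Γ(c₂−y)·Γ(d+y) / Γ(a₁+a₂+b₁+b₂+c₁+c₂+d+y)] ds dt = Γ(a₁+a₂)·Γ(b₁+b₂)·Γ(c₁+c₂)·Γ(a₂+b₁+c₁)·Γ(a₁+b₂+c₂)·Γ(a₂+b₁+d)·Γ(c₂+d) / (Γ(a₁+a₂+b₁+b₂+c₁+c₂)·Γ(a₁+a₂+b₁+b₂+c₂+d)·Γ(a₂+b₁+c₁+c₂+d)). -/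
open MeasureTheory

namespace MB
open Complex Set

lemma norm_Gamma_le {z : ℂ} (hz : 0 < z.re) : ‖Complex.Gamma z‖ ≤ Real.Gamma z.re := by
  rw [Complex.Gamma_eq_integral hz, Complex.GammaIntegral, Real.Gamma_eq_integral hz]
  refine (norm_integral_le_integral_norm _).trans (le_of_eq ?_)
  refine setIntegral_congr_fun measurableSet_Ioi fun x hx => ?_
  have hx : 0 < x := hx
  simp only [norm_mul, norm_cpow_eq_rpow_re_of_pos hx, norm_real, sub_re, one_re,
    Real.norm_eq_abs, Real.abs_exp]

lemma cont_Gamma {X : Type*} [TopologicalSpace X] {f : X → ℂ} (hf : Continuous f)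
    (h : ∀ t, 0 < (f t).re) : Continuous fun t => Complex.Gamma (f t) := by
  rw [continuous_iff_continuousAt]
  intro t
  refine ContinuousAt.comp (g := Complex.Gamma) ?_ hf.continuousAt
  refine (Complex.differentiableAt_Gamma _ fun m hm => ?_).continuousAt
  have := h t
  rw [hm] at this
  simp at this
  have h2 : (0:ℝ) ≤ m := Nat.cast_nonneg m
  linarith

/-- quadratic decay -/
lemma decay {a c : ℂ} (ha : 0 < a.re) (hc : 0 < c.re) :
    ∃ C : ℝ, 0 ≤ C ∧ ∀ t : ℝ,
      ‖Complex.Gamma (a + t * I) * Complex.Gamma (c - t * I)‖ ≤ C * (1 + t ^ 2)⁻¹ := by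
  have key : ∀ {a : ℂ}, 0 < a.re → ∃ C : ℝ, 0 ≤ C ∧ ∀ t : ℝ,
      ‖Complex.Gamma (a + t * I)‖ ^ 2 * (1 + t ^ 2) ≤ C ^ 2 := by
    intro a ha
    refine ⟨Real.sqrt ((Real.Gamma (a.re)) ^ 2 * (1 + 2 * a.im ^ 2) + 2 *
      Real.Gamma (a.re + 1) ^ 2), Real.sqrt_nonneg _, fun t => ?_⟩
    rw [Real.sq_sqrt (by positivity)]
    have hz : 0 < (a + t * I).re := by simpa using ha
    have h1 := norm_Gamma_le hz
    have hz0 : a + t * I ≠ 0 := by intro h; rw [h] at hz; simp at hz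
    have h2 := norm_Gamma_le (z := a + t * I + 1) (by rw [add_re, one_re]; linarith)
    rw [Complex.Gamma_add_one _ hz0, norm_mul] at h2
    have e1 : (a + t * I).re = a.re := by simp
    have e2 : (a + t * I + 1).re = a.re + 1 := by simp
    rw [e1] at h1
    rw [e2] at h2
    have h3 : |a.im + t| ≤ ‖a + t * I‖ := by
      have := Complex.abs_im_le_norm (a + t * I)
      simpa using this
    set g := ‖Complex.Gamma (a + t * I)‖
    have hg : 0 ≤ g := norm_nonneg _
    have h4 : |a.im + t| * g ≤ Real.Gamma (a.re + 1) :=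
      (mul_le_mul_of_nonneg_right h3 hg).trans h2
    have h5 : (a.im + t) ^ 2 * g ^ 2 ≤ Real.Gamma (a.re + 1) ^ 2 := by
      rw [← sq_abs (a.im + t), ← mul_pow]
      exact pow_le_pow_left₀ (by positivity) h4 2
    have h6 : g ^ 2 ≤ Real.Gamma a.re ^ 2 := pow_le_pow_left₀ hg h1 2
    have h7 : t ^ 2 ≤ 2 * a.im ^ 2 + 2 * (a.im + t) ^ 2 := by nlinarith [sq_nonneg (2 * a.im + t)]
    calc g ^ 2 * (1 + t ^ 2) ≤ g ^ 2 * (1 + 2 * a.im ^ 2 + 2 * (a.im + t) ^ 2) := by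
          apply mul_le_mul_of_nonneg_left _ (sq_nonneg g); linarith
      _ = g ^ 2 * (1 + 2 * a.im ^ 2) + 2 * ((a.im + t) ^ 2 * g ^ 2) := by ring
      _ ≤ _ := by
          have := mul_le_mul_of_nonneg_right h6 (by positivity : 0 ≤ 1 + 2 * a.im ^ 2)
          linarith
  obtain ⟨C1, hC1, h1⟩ := key ha
  obtain ⟨C2, hC2, h2⟩ := key hc
  refine ⟨C1 * C2, mul_nonneg hC1 hC2, fun t => ?_⟩
  have h1 := h1 t
  have h2 := h2 (-t)
  have e : c + ((-t : ℝ) : ℂ) * I = c - t * I := by push_cast; ring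
  rw [e, neg_sq] at h2
  rw [norm_mul]
  have hp : 0 < 1 + t ^ 2 := by positivity
  rw [← div_eq_mul_inv, le_div_iff₀ hp]
  refine abs_le_of_sq_le_sq' ?_ (mul_nonneg hC1 hC2) |>.2
  calc _ = (‖Complex.Gamma (a + t * I)‖ ^ 2 * (1 + t ^ 2)) *
        (‖Complex.Gamma (c - t * I)‖ ^ 2 * (1 + t ^ 2)) := by ring
    _ ≤ C1 ^ 2 * C2 ^ 2 := mul_le_mul h1 h2 (by positivity) (by positivity)
    _ = _ := by ring

lemma beta_aux {p q : ℂ} {u : ℝ} (hu : 0 < u) :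
    |1 / (1 + u) ^ 2| • (((u / (1 + u) : ℝ) : ℂ) ^ (p - 1) *
      (1 - ((u / (1 + u) : ℝ) : ℂ)) ^ (q - 1)) =
    (u : ℂ) ^ (p - 1) * ((1 + u : ℝ) : ℂ) ^ (-(p + q)) := by
  have h1 : 0 < 1 + u := by linarith
  have e1 : 1 - ((u / (1 + u) : ℝ) : ℂ) = (((1 + u)⁻¹ : ℝ) : ℂ) := by
    rw [← ofReal_one, ← ofReal_sub]; congr 1; field_simp; ring
  rw [e1, abs_of_pos (by positivity), div_eq_mul_inv u, ofReal_mul,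
    mul_cpow_ofReal_nonneg hu.le (by positivity)]
  have h0 : ((1 + u : ℝ) : ℂ) ≠ 0 := ofReal_ne_zero.2 h1.ne'
  have harg : ((1 + u : ℝ) : ℂ).arg ≠ Real.pi := by
    rw [arg_ofReal_of_nonneg h1.le]; exact Real.pi_ne_zero.symm
  rw [ofReal_inv, inv_cpow _ _ harg, inv_cpow _ _ harg, ← cpow_neg, ← cpow_neg]
  have e2 : -(p + q) = -(p - 1) + -(q - 1) + (-2 : ℂ) := by ring
  rw [e2, cpow_add _ _ h0, cpow_add _ _ h0]
  have e3 : ((1 + u : ℝ) : ℂ) ^ (-2 : ℂ) = ((1 / (1 + u) ^ 2 : ℝ) : ℂ) := by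
    rw [cpow_neg]; norm_cast; simp
  rw [e3, real_smul]; ring

lemma image_aux : (fun u : ℝ => u / (1 + u)) '' Ioi 0 = Ioo 0 1 := by
  ext x
  constructor
  · rintro ⟨u, hu, rfl⟩
    have hu : 0 < u := hu
    refine ⟨by positivity, ?_⟩
    simp only
    rw [div_lt_one (by linarith)]; linarith
  · rintro ⟨h0, h1⟩
    have : 0 < 1 - x := by linarith
    refine ⟨x / (1 - x), div_pos h0 this, ?_⟩
    simp only
    field_simp; ring

lemma inj_aux : InjOn (fun u : ℝ => u / (1 + u)) (Ioi 0) := by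
  intro u hu v hv h
  have hu : 0 < u := hu
  have hv : 0 < v := hv
  simp only at h
  rw [div_eq_div_iff (by positivity) (by positivity)] at h
  linarith

lemma deriv_aux : ∀ u ∈ Ioi (0:ℝ),
    HasDerivWithinAt (fun u : ℝ => u / (1 + u)) (1 / (1 + u) ^ 2) (Ioi 0) u := by
  intro u hu
  have hu : 0 < u := hu
  have := (hasDerivAt_id u).div ((hasDerivAt_id u).const_add 1) (by simp; linarith)
  simp at this
  convert! this.hasDerivWithinAt using 1
  simp

lemma beta_integrable {p q : ℂ} (hp : 0 < p.re) (hq : 0 < q.re) :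
    IntegrableOn (fun u : ℝ => (u : ℂ) ^ (p - 1) * ((1 + u : ℝ) : ℂ) ^ (-(p + q))) (Ioi 0) := by
  have h := betaIntegral_convergent hp hq
  rw [intervalIntegrable_iff_integrableOn_Ioo_of_le zero_le_one, ← image_aux,
    integrableOn_image_iff_integrableOn_abs_deriv_smul measurableSet_Ioi deriv_aux inj_aux] at h
  exact h.congr_fun (fun u hu => beta_aux hu) measurableSet_Ioi

lemma beta_integral {p q : ℂ} (hp : 0 < p.re) (hq : 0 < q.re) :
    ∫ u in Ioi (0:ℝ), (u : ℂ) ^ (p - 1) * ((1 + u : ℝ) : ℂ) ^ (-(p + q)) =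
      Complex.Gamma p * Complex.Gamma q / Complex.Gamma (p + q) := by
  rw [← betaIntegral_eq_Gamma_mul_div _ _ hp hq, betaIntegral,
    intervalIntegral.integral_of_le zero_le_one, integral_Ioc_eq_integral_Ioo, ← image_aux,
    integral_image_eq_integral_abs_deriv_smul measurableSet_Ioi deriv_aux inj_aux]
  exact (setIntegral_congr_fun measurableSet_Ioi fun u hu => beta_aux hu).symm

lemma ratio_bound {d e : ℂ} (hd : 0 < d.re) (he : 0 < e.re) :
    ∃ C : ℝ, 0 ≤ C ∧ ∀ t : ℝ,
      ‖Complex.Gamma (d + t * I) / Complex.Gamma (d + e + t * I)‖ ≤ C := by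
  have hG := Gamma_ne_zero_of_re_pos he
  refine ⟨(∫ u in Ioi (0:ℝ), ‖(u : ℂ) ^ (d - 1) * ((1 + u : ℝ) : ℂ) ^ (-(d + e))‖) /
    ‖Complex.Gamma e‖, by positivity, fun t => ?_⟩
  rw [le_div_iff₀ (norm_pos_iff.2 hG), ← norm_mul]
  have hd' : 0 < (d + t * I).re := by simpa using hd
  have h := beta_integral hd' he
  have e0 : Complex.Gamma (d + t * I) / Complex.Gamma (d + e + t * I) * Complex.Gamma e =
      Complex.Gamma (d + t * I) * Complex.Gamma e / Complex.Gamma (d + t * I + e) := by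
    rw [show d + e + t * I = d + t * I + e by ring]; ring
  rw [e0, ← h]
  refine (norm_integral_le_integral_norm _).trans (le_of_eq ?_)
  refine setIntegral_congr_fun measurableSet_Ioi fun u hu => ?_
  have hu : 0 < u := hu
  simp only [norm_mul]
  rw [norm_cpow_eq_rpow_re_of_pos hu, norm_cpow_eq_rpow_re_of_pos hu,
    norm_cpow_eq_rpow_re_of_pos (by linarith), norm_cpow_eq_rpow_re_of_pos (by linarith)]
  simp

lemma integrable_G {a c : ℂ} (ha : 0 < a.re) (hc : 0 < c.re) :
    Integrable fun t : ℝ => Complex.Gamma (a + t * I) * Complex.Gamma (c - t * I) := by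
  obtain ⟨C, hC, h⟩ := decay ha hc
  refine Integrable.mono' (integrable_inv_one_add_sq.const_mul C) ?_ (Filter.Eventually.of_forall h)
  refine Continuous.aestronglyMeasurable (Continuous.mul ?_ ?_)
  · exact cont_Gamma (by fun_prop) (by simpa using ha)
  · exact cont_Gamma (by fun_prop) (by simpa using hc)

lemma inv_G {a c : ℂ} (ha : 0 < a.re) (hc : 0 < c.re) {u : ℝ} (hu : 0 < u) :
    ∫ t : ℝ, Complex.Gamma (a + t * I) * Complex.Gamma (c - t * I) * cexp (t * I * Real.log u) =
      2 * Real.pi * Complex.Gamma (a + c) * ((u : ℂ) ^ c * ((1 + u : ℝ) : ℂ) ^ (-(a + c))) := by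
  have hG : Complex.Gamma (a + c) ≠ 0 := Gamma_ne_zero_of_re_pos (by rw [add_re]; linarith)
  let f : ℝ → ℂ := fun x => (x : ℂ) ^ a * ((1 + x : ℝ) : ℂ) ^ (-(a + c))
  have hker : ∀ (y : ℝ) (x : ℝ), x ∈ Ioi (0:ℝ) →
      (x : ℂ) ^ (a + y * I - 1) * ((1 + x : ℝ) : ℂ) ^ (-((a + y * I) + (c - y * I))) =
      (x : ℂ) ^ (((0 : ℝ) : ℂ) + y * I - 1) • f x := by
    intro y x hx
    have hx : 0 < x := hx
    have hx0 : (x : ℂ) ≠ 0 := ofReal_ne_zero.2 hx.ne'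
    simp only [f, smul_eq_mul]
    rw [show a + y * I - 1 = (((0 : ℝ) : ℂ) + y * I - 1) + a by push_cast; ring, cpow_add _ _ hx0,
      show (a + y * I) + (c - y * I) = a + c by ring]
    ring
  have hmel : ∀ y : ℝ, mellin f (((0 : ℝ) : ℂ) + y * I) =
      Complex.Gamma (a + y * I) * Complex.Gamma (c - y * I) / Complex.Gamma (a + c) := by
    intro y
    have h := beta_integral (p := a + y * I) (q := c - y * I) (by simpa using ha) (by simpa using hc)
    rw [setIntegral_congr_fun measurableSet_Ioi (hker y)] at h
    rw [mellin, h, show (a + y * I) + (c - y * I) = a + c by ring]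
  have hconv : MellinConvergent f ((0 : ℝ) : ℂ) := by
    have h := beta_integrable (p := a + (0:ℝ) * I) (q := c - (0:ℝ) * I) (by simpa using ha)
      (by simpa using hc)
    have := h.congr_fun (hker 0) measurableSet_Ioi
    simpa [MellinConvergent] using this
  have hvert : VerticalIntegrable (mellin f) 0 := by
    unfold VerticalIntegrable
    simp_rw [hmel]
    exact (integrable_G ha hc).div_const _
  have hu' : 0 < u⁻¹ := inv_pos.2 hu
  have hcont : ContinuousAt f u⁻¹ := by
    refine ContinuousAt.mul (ContinuousAt.cpow (by fun_prop) (by fun_prop) ?_)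
      (ContinuousAt.cpow (by fun_prop) (by fun_prop) ?_)
    · exact ofReal_mem_slitPlane.2 hu'
    · exact ofReal_mem_slitPlane.2 (by linarith)
  have key := mellinInv_mellin_eq 0 f hu' hconv hvert hcont
  rw [mellinInv] at key
  simp_rw [hmel] at key
  have e1 : ∀ y : ℝ, ((u⁻¹ : ℝ) : ℂ) ^ (-(((0 : ℝ) : ℂ) + y * I)) •
      (Complex.Gamma (a + y * I) * Complex.Gamma (c - y * I) / Complex.Gamma (a + c)) =
      Complex.Gamma (a + y * I) * Complex.Gamma (c - y * I) * cexp (y * I * Real.log u) /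
        Complex.Gamma (a + c) := by
    intro y
    rw [cpow_def_of_ne_zero (ofReal_ne_zero.2 hu'.ne'), ← ofReal_log hu'.le, Real.log_inv, smul_eq_mul]
    rw [show ((-Real.log u : ℝ) : ℂ) * -(((0 : ℝ) : ℂ) + y * I) = y * I * Real.log u by
      push_cast; ring]
    ring
  simp_rw [e1, integral_div] at key
  have e2 : f u⁻¹ = (u : ℂ) ^ c * ((1 + u : ℝ) : ℂ) ^ (-(a + c)) := by
    simp only [f]
    have harg : (u : ℂ).arg ≠ Real.pi := by
      rw [arg_ofReal_of_nonneg hu.le]; exact Real.pi_ne_zero.symm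
    have hu0 : (u : ℂ) ≠ 0 := ofReal_ne_zero.2 hu.ne'
    rw [show (1 + u⁻¹ : ℝ) = (1 + u) * u⁻¹ by field_simp; ring, ofReal_mul,
      mul_cpow_ofReal_nonneg (by linarith) hu'.le, ofReal_inv, inv_cpow _ _ harg,
      inv_cpow _ _ harg, ← cpow_neg, ← cpow_neg]
    rw [show c = -a + - (-(a + c)) by ring, cpow_add _ _ hu0]
    rw [show a + (-a + - (-(a + c))) = a + c by ring]
    ring
  rw [e2] at key
  rw [← key, real_smul]
  have hpi : (Real.pi : ℂ) ≠ 0 := ofReal_ne_zero.2 Real.pi_ne_zero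
  generalize (∫ t : ℝ, Complex.Gamma (a + t * I) * Complex.Gamma (c - t * I) *
    cexp (t * I * Real.log u)) = J
  push_cast
  field_simp

lemma barnes1 {a b c d : ℂ} (ha : 0 < a.re) (hb : 0 < b.re) (hc : 0 < c.re) (hd : 0 < d.re) :
    ∫ t : ℝ, Complex.Gamma (a + t * I) * Complex.Gamma (b + t * I) *
        Complex.Gamma (c - t * I) * Complex.Gamma (d - t * I) =
      2 * Real.pi * (Complex.Gamma (a + c) * Complex.Gamma (a + d) * Complex.Gamma (b + c) *
        Complex.Gamma (b + d) / Complex.Gamma (a + b + c + d)) := by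
  have hGbd : Complex.Gamma (b + d) ≠ 0 := Gamma_ne_zero_of_re_pos (by rw [add_re]; linarith)
  let G : ℝ → ℂ := fun t => Complex.Gamma (a + t * I) * Complex.Gamma (c - t * I)
  let k : ℝ → ℂ := fun u => (u : ℂ) ^ (b - 1) * ((1 + u : ℝ) : ℂ) ^ (-(b + d))
  have hG : Integrable G := integrable_G ha hc
  have hk : Integrable k (volume.restrict (Ioi 0)) := beta_integrable hb hd
  have hprod : Integrable (fun z : ℝ × ℝ => cexp (z.1 * I * Real.log z.2) * (G z.1 * k z.2))
      (volume.prod (volume.restrict (Ioi 0))) := by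
    refine (hG.mul_prod hk).bdd_mul (c := 1) ?_ ?_
    · refine Measurable.aestronglyMeasurable ?_
      fun_prop
    · refine Filter.Eventually.of_forall fun z => ?_
      rw [show (z.1 : ℂ) * I * Real.log z.2 = ((z.1 * Real.log z.2 : ℝ) : ℂ) * I by push_cast; ring,
        norm_exp_ofReal_mul_I]
  have h2 : ∀ t : ℝ, Complex.Gamma (b + t * I) * Complex.Gamma (d - t * I) =
      Complex.Gamma (b + d) * ∫ u in Ioi (0:ℝ), cexp (t * I * Real.log u) * k u := by
    intro t
    have h := beta_integral (p := b + t * I) (q := d - t * I) (by simpa using hb) (by simpa using hd)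
    rw [show (b + t * I) + (d - t * I) = b + d by ring] at h
    rw [eq_div_iff hGbd] at h
    rw [← h, mul_comm]
    congr 1
    refine setIntegral_congr_fun measurableSet_Ioi fun u hu => ?_
    have hu : 0 < u := hu
    have hu0 : (u : ℂ) ≠ 0 := ofReal_ne_zero.2 hu.ne'
    simp only [k]
    rw [show b + t * I - 1 = t * I + (b - 1) by ring, cpow_add _ _ hu0,
      cpow_def_of_ne_zero hu0 (t * I), ← ofReal_log hu.le, mul_comm (Real.log u : ℂ)]
    ring
  calc _ = ∫ t : ℝ, Complex.Gamma (b + d) *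
        ∫ u in Ioi (0:ℝ), cexp (t * I * Real.log u) * (G t * k u) := by
        congr 1; ext t
        rw [show Complex.Gamma (a + t * I) * Complex.Gamma (b + t * I) *
          Complex.Gamma (c - t * I) * Complex.Gamma (d - t * I) =
          (Complex.Gamma (b + t * I) * Complex.Gamma (d - t * I)) * G t by simp only [G]; ring, h2,
          mul_assoc, ← integral_mul_const]
        congr 2; ext u; ring
    _ = Complex.Gamma (b + d) * ∫ u in Ioi (0:ℝ), ∫ t : ℝ,
          cexp (t * I * Real.log u) * (G t * k u) := by
        rw [integral_const_mul, integral_integral_swap hprod]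
    _ = Complex.Gamma (b + d) * ∫ u in Ioi (0:ℝ), (2 * Real.pi * Complex.Gamma (a + c)) *
          ((u : ℂ) ^ (b + c - 1) * ((1 + u : ℝ) : ℂ) ^ (-((b + c) + (a + d)))) := by
        congr 1
        refine setIntegral_congr_fun measurableSet_Ioi fun u hu => ?_
        have hu : 0 < u := hu
        have hu0 : (u : ℂ) ≠ 0 := ofReal_ne_zero.2 hu.ne'
        have h10 : ((1 + u : ℝ) : ℂ) ≠ 0 := ofReal_ne_zero.2 (by linarith)
        have h := inv_G ha hc hu
        have e : ∀ t : ℝ, cexp (t * I * Real.log u) * (G t * k u) =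
          (Complex.Gamma (a + t * I) * Complex.Gamma (c - t * I) * cexp (t * I * Real.log u)) * k u :=
          fun t => by simp only [G]; ring
        simp_rw [e]
        rw [integral_mul_const, h]
        simp only [k]
        rw [show b + c - 1 = c + (b - 1) by ring, cpow_add _ _ hu0,
          show -((b + c) + (a + d)) = -(a + c) + -(b + d) by ring, cpow_add _ _ h10]
        ring
    _ = _ := by
        rw [integral_const_mul, beta_integral (by rw [add_re]; linarith) (by rw [add_re]; linarith),
          show (b + c) + (a + d) = a + b + c + d by ring]
        ring

lemma barnes2 {a b c d e : ℂ} (ha : 0 < a.re) (hb : 0 < b.re) (hc : 0 < c.re) (hd : 0 < d.re)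
    (he : 0 < e.re) :
    ∫ t : ℝ, Complex.Gamma (a + t * I) * Complex.Gamma (b + t * I) * Complex.Gamma (c + t * I) *
        Complex.Gamma (d - t * I) * Complex.Gamma (e - t * I) /
        Complex.Gamma (a + b + c + d + e + t * I) =
      2 * Real.pi * (Complex.Gamma (a + d) * Complex.Gamma (a + e) * Complex.Gamma (b + d) *
        Complex.Gamma (b + e) * Complex.Gamma (c + d) * Complex.Gamma (c + e) /
        (Complex.Gamma (a + b + d + e) * Complex.Gamma (a + c + d + e) *
          Complex.Gamma (b + c + d + e))) := by
  obtain ⟨ε, hε, hεa, hεb⟩ : ∃ ε : ℝ, 0 < ε ∧ ε < a.re ∧ ε < b.re :=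
    ⟨min a.re b.re / 2, by positivity,
      by have := min_le_left a.re b.re; have : 0 < min a.re b.re := lt_min ha hb; linarith,
      by have := min_le_right a.re b.re; have : 0 < min a.re b.re := lt_min ha hb; linarith⟩
  have haε : 0 < (a - ε).re := by simpa using hεa
  have hbε : 0 < (b - ε).re := by simpa using hεb
  have huε : 0 < (c + d + e + ε).re := by simp; linarith
  have hdε : 0 < (d + ε).re := by simp; linarith
  have heε : 0 < (e + ε).re := by simp; linarith
  have hGa : Complex.Gamma (a + c + d + e) ≠ 0 :=
    Gamma_ne_zero_of_re_pos (by simp only [add_re]; linarith)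
  have hGb : Complex.Gamma (b + c + d + e) ≠ 0 :=
    Gamma_ne_zero_of_re_pos (by simp only [add_re]; linarith)
  have hpi : (2 * Real.pi : ℂ) ≠ 0 := mul_ne_zero two_ne_zero (ofReal_ne_zero.2 Real.pi_ne_zero)
  let B : ℝ × ℝ → ℂ := fun q => Complex.Gamma (e - q.1 * I) *
    Complex.Gamma (ε + q.1 * I - q.2 * I) * Complex.Gamma (b - ε + q.2 * I)
  let F : ℝ × ℝ → ℂ := fun q => B q *
    ((Complex.Gamma (c + q.1 * I) * Complex.Gamma (d - q.1 * I)) *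
    (Complex.Gamma (a - ε + q.2 * I) * Complex.Gamma (c + d + e + ε - q.2 * I)))
  have hF : Integrable F (volume.prod volume) := by
    refine ((integrable_G hc hd).mul_prod (integrable_G haε huε)).bdd_mul
      (c := Real.Gamma e.re * Real.Gamma ε * Real.Gamma (b - ε).re) ?_ ?_
    · refine Continuous.aestronglyMeasurable ((Continuous.mul ?_ ?_).mul ?_)
      · exact cont_Gamma (by fun_prop) (by simpa using he)
      · exact cont_Gamma (by fun_prop) (by simpa using hε)
      · exact cont_Gamma (by fun_prop) (by simpa using hεb)
    · refine Filter.Eventually.of_forall fun q => ?_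
      have n1 := norm_Gamma_le (z := e - q.1 * I) (by simpa using he)
      have n2 := norm_Gamma_le (z := ε + q.1 * I - q.2 * I) (by simpa using hε)
      have n3 := norm_Gamma_le (z := b - ε + q.2 * I) (by simpa using hεb)
      rw [show (e - q.1 * I).re = e.re by simp] at n1
      rw [show (ε + q.1 * I - q.2 * I).re = ε by simp] at n2
      rw [show (b - ε + q.2 * I).re = (b - ε).re by simp] at n3
      simp only [B, norm_mul]
      gcongr
  have hs : ∀ t : ℝ, ∫ s : ℝ, F (t, s) =
      2 * Real.pi * (Complex.Gamma (a + c + d + e) * Complex.Gamma (b + c + d + e)) *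
      (Complex.Gamma (a + t * I) * Complex.Gamma (b + t * I) * Complex.Gamma (c + t * I) *
        Complex.Gamma (d - t * I) * Complex.Gamma (e - t * I) /
        Complex.Gamma (a + b + c + d + e + t * I)) := by
    intro t
    have h := barnes1 haε hbε (c := ε + t * I) (by simpa using hε) huε
    have e1 : ∀ s : ℝ, F (t, s) =
      (Complex.Gamma (e - t * I) * Complex.Gamma (c + t * I) * Complex.Gamma (d - t * I)) *
      (Complex.Gamma (a - ε + s * I) * Complex.Gamma (b - ε + s * I) *
        Complex.Gamma (ε + t * I - s * I) * Complex.Gamma (c + d + e + ε - s * I)) := fun s => by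
      simp only [F, B]; ring
    simp_rw [e1]
    rw [integral_const_mul, h]
    rw [show a - ε + (ε + t * I) = a + t * I by ring, show b - ε + (ε + t * I) = b + t * I by ring,
      show a - ε + (c + d + e + ε) = a + c + d + e by ring,
      show b - ε + (c + d + e + ε) = b + c + d + e by ring,
      show a - ε + (b - ε) + (ε + t * I) + (c + d + e + ε) = a + b + c + d + e + t * I by ring]
    ring
  have ht : ∀ s : ℝ, ∫ t : ℝ, F (t, s) =
      2 * Real.pi * (Complex.Gamma (c + d) * Complex.Gamma (c + e)) *
      (Complex.Gamma (a - ε + s * I) * Complex.Gamma (b - ε + s * I) *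
        Complex.Gamma (d + ε - s * I) * Complex.Gamma (e + ε - s * I)) := by
    intro s
    have h := barnes1 hc (b := ε - s * I) (by simpa using hε) hd he
    have hGu : Complex.Gamma (c + d + e + ε - s * I) ≠ 0 :=
      Gamma_ne_zero_of_re_pos (by simp; linarith)
    have e1 : ∀ t : ℝ, F (t, s) =
      (Complex.Gamma (a - ε + s * I) * Complex.Gamma (b - ε + s * I) *
        Complex.Gamma (c + d + e + ε - s * I)) *
      (Complex.Gamma (c + t * I) * Complex.Gamma (ε - s * I + t * I) *
        Complex.Gamma (d - t * I) * Complex.Gamma (e - t * I)) := fun t => by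
      simp only [F, B]
      rw [show ε + t * I - s * I = ε - s * I + t * I by ring]; ring
    simp_rw [e1]
    rw [integral_const_mul, h]
    rw [show ε - s * I + d = d + ε - s * I by ring, show ε - s * I + e = e + ε - s * I by ring,
      show c + (ε - s * I) + d + e = c + d + e + ε - s * I by ring]
    rw [mul_div_assoc', mul_div_assoc', div_eq_iff hGu]
    ring
  have hswap := integral_integral_swap (f := fun t s => F (t, s)) hF
  simp_rw [hs, ht] at hswap
  rw [integral_const_mul, integral_const_mul, barnes1 haε hbε hdε heε] at hswap
  rw [show a - ε + (d + ε) = a + d by ring, show a - ε + (e + ε) = a + e by ring,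
    show b - ε + (d + ε) = b + d by ring, show b - ε + (e + ε) = b + e by ring,
    show a - ε + (b - ε) + (d + ε) + (e + ε) = a + b + d + e by ring] at hswap
  refine mul_left_cancel₀ (mul_ne_zero hpi (mul_ne_zero hGa hGb)) (hswap.trans ?_)
  have hG3 : Complex.Gamma (a + b + d + e) ≠ 0 :=
    Gamma_ne_zero_of_re_pos (by simp only [add_re]; linarith)
  field_simp

end MB

local notation "Γ" => Complex.Gamma

/-- Two-fold Mellin–Barnes integral with seven numerator Gamma factors and a balanced
Gamma denominator, evaluated via Barnes' first lemma in `x` followed by Barnes' second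
lemma in `y` (the paper's eqs. (C.17)–(C.18)).  Here `x = σₓ + i s` and `y = σᵧ + i t`. -/
theorem two_fold_mellin_barnes_second_lemma
    (a₁ a₂ b₁ b₂ c₁ c₂ d : ℂ) (σx σy : ℝ)
    (h₁ : 0 < a₁.re + σx) (h₂ : 0 < a₂.re - σx)
    (h₃ : 0 < b₁.re + σx - σy) (h₄ : 0 < b₂.re - σx + σy)
    (h₅ : 0 < c₁.re + σy) (h₆ : 0 < c₂.re - σy) (h₇ : 0 < d.re + σy) :
    (1 / (2 * (Real.pi : ℂ))) ^ 2 *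
      (∫ q : ℝ × ℝ,
        let x : ℂ := (σx : ℂ) + (q.1 : ℂ) * Complex.I
        let y : ℂ := (σy : ℂ) + (q.2 : ℂ) * Complex.I
        Γ (a₁ + x) * Γ (a₂ - x) * Γ (b₁ + x - y) * Γ (b₂ - x + y) *
            Γ (c₁ + y) * Γ (c₂ - y) * Γ (d + y) /
          Γ (a₁ + a₂ + b₁ + b₂ + c₁ + c₂ + d + y)) =
      Γ (a₁ + a₂) * Γ (b₁ + b₂) * Γ (c₁ + c₂) * Γ (a₂ + b₁ + c₁) * Γ (a₁ + b₂ + c₂) *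
          Γ (a₂ + b₁ + d) * Γ (c₂ + d) /
        (Γ (a₁ + a₂ + b₁ + b₂ + c₁ + c₂) * Γ (a₁ + a₂ + b₁ + b₂ + c₂ + d) *
          Γ (a₂ + b₁ + c₁ + c₂ + d)) := by
  have q1 : 0 < (a₁ + σx).re := by simpa using h₁
  have q2 : 0 < (a₂ - σx).re := by simpa using h₂
  have q3 : 0 < (b₁ + σx - σy).re := by simpa using h₃
  have q4 : 0 < (b₂ - σx + σy).re := by simpa using h₄
  have q5 : 0 < (c₁ + σy).re := by simpa using h₅
  have q6 : 0 < (c₂ - σy).re := by simpa using h₆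
  have q7 : 0 < (d + σy).re := by simpa using h₇
  have q8 : 0 < (a₁ + a₂ + b₁ + b₂ + c₁ + c₂).re := by
    simp only [Complex.add_re]; linarith
  have hpi : (Real.pi : ℂ) ≠ 0 := Complex.ofReal_ne_zero.2 Real.pi_ne_zero
  have hGab : Γ (a₁ + a₂ + b₁ + b₂) ≠ 0 :=
    Complex.Gamma_ne_zero_of_re_pos (by simp only [Complex.add_re]; linarith)
  let B : ℝ × ℝ → ℂ := fun q => Γ (b₁ + σx - σy + q.1 * Complex.I - q.2 * Complex.I) *
    Γ (b₂ - σx + σy - q.1 * Complex.I + q.2 * Complex.I) *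
    (Γ (d + σy + q.2 * Complex.I) /
      Γ (d + σy + (a₁ + a₂ + b₁ + b₂ + c₁ + c₂) + q.2 * Complex.I))
  let F : ℝ × ℝ → ℂ := fun q => B q *
    ((Γ (a₁ + σx + q.1 * Complex.I) * Γ (a₂ - σx - q.1 * Complex.I)) *
    (Γ (c₁ + σy + q.2 * Complex.I) * Γ (c₂ - σy - q.2 * Complex.I)))
  have hF : Integrable F (volume.prod volume) := by
    obtain ⟨C, hC, hCb⟩ := MB.ratio_bound q7 q8
    refine ((MB.integrable_G q1 q2).mul_prod (MB.integrable_G q5 q6)).bdd_mul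
      (c := Real.Gamma (b₁ + σx - σy).re * Real.Gamma (b₂ - σx + σy).re * C) ?_ ?_
    · refine Continuous.aestronglyMeasurable ((Continuous.mul ?_ ?_).mul (Continuous.div ?_ ?_ ?_))
      · exact MB.cont_Gamma (by fun_prop) (by simpa using h₃)
      · exact MB.cont_Gamma (by fun_prop) (by simpa using h₄)
      · exact MB.cont_Gamma (by fun_prop) (by simpa using h₇)
      · exact MB.cont_Gamma (by fun_prop) (fun t => by simp at q7 q8 ⊢; linarith)
      · exact fun t => Complex.Gamma_ne_zero_of_re_pos (by simp at q7 q8 ⊢; linarith)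
    · refine Filter.Eventually.of_forall fun q => ?_
      have n1 := MB.norm_Gamma_le (z := b₁ + σx - σy + q.1 * Complex.I - q.2 * Complex.I)
        (by simpa using h₃)
      have n2 := MB.norm_Gamma_le (z := b₂ - σx + σy - q.1 * Complex.I + q.2 * Complex.I)
        (by simpa using h₄)
      rw [show (b₁ + σx - σy + q.1 * Complex.I - q.2 * Complex.I).re = (b₁ + σx - σy).re by
        simp] at n1
      rw [show (b₂ - σx + σy - q.1 * Complex.I + q.2 * Complex.I).re = (b₂ - σx + σy).re by
        simp] at n2
      have n3 := hCb q.2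
      simp only [B]
      rw [norm_mul, norm_mul]
      gcongr
  have hFeq : ∀ q : ℝ × ℝ, (let x : ℂ := (σx : ℂ) + (q.1 : ℂ) * Complex.I
        let y : ℂ := (σy : ℂ) + (q.2 : ℂ) * Complex.I
        Γ (a₁ + x) * Γ (a₂ - x) * Γ (b₁ + x - y) * Γ (b₂ - x + y) *
            Γ (c₁ + y) * Γ (c₂ - y) * Γ (d + y) /
          Γ (a₁ + a₂ + b₁ + b₂ + c₁ + c₂ + d + y)) = F q := by
    intro q
    simp only [F, B]
    generalize (q.1 : ℂ) * Complex.I = s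
    generalize (q.2 : ℂ) * Complex.I = t
    rw [show a₁ + (σx + s) = a₁ + σx + s by ring, show a₂ - (σx + s) = a₂ - σx - s by ring,
      show b₁ + (σx + s) - (σy + t) = b₁ + σx - σy + s - t by ring,
      show b₂ - (σx + s) + (σy + t) = b₂ - σx + σy - s + t by ring,
      show c₁ + (σy + t) = c₁ + σy + t by ring, show c₂ - (σy + t) = c₂ - σy - t by ring,
      show d + (σy + t) = d + σy + t by ring,
      show a₁ + a₂ + b₁ + b₂ + c₁ + c₂ + d + (σy + t) =
        d + σy + (a₁ + a₂ + b₁ + b₂ + c₁ + c₂) + t by ring]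
    ring
  have hx : ∀ t : ℝ, ∫ s : ℝ, F (s, t) =
      (2 * Real.pi * (Γ (a₁ + a₂) * Γ (b₁ + b₂) / Γ (a₁ + a₂ + b₁ + b₂))) *
      (Γ (a₁ + b₂ + σy + t * Complex.I) * Γ (c₁ + σy + t * Complex.I) *
        Γ (d + σy + t * Complex.I) * Γ (c₂ - σy - t * Complex.I) *
        Γ (a₂ + b₁ - σy - t * Complex.I) /
        Γ (a₁ + b₂ + σy + (c₁ + σy) + (d + σy) + (c₂ - σy) + (a₂ + b₁ - σy) +
          t * Complex.I)) := by
    intro t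
    have h := MB.barnes1 q1 (b := b₁ + σx - σy - t * Complex.I) (by simpa using h₃) q2
      (d := b₂ - σx + σy + t * Complex.I) (by simpa using h₄)
    have e1 : ∀ s : ℝ, F (s, t) =
      (Γ (c₁ + σy + t * Complex.I) * Γ (c₂ - σy - t * Complex.I) *
        (Γ (d + σy + t * Complex.I) /
          Γ (d + σy + (a₁ + a₂ + b₁ + b₂ + c₁ + c₂) + t * Complex.I))) *
      (Γ (a₁ + σx + s * Complex.I) * Γ (b₁ + σx - σy - t * Complex.I + s * Complex.I) *
        Γ (a₂ - σx - s * Complex.I) * Γ (b₂ - σx + σy + t * Complex.I - s * Complex.I)) := by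
      intro s
      simp only [F, B]
      rw [show b₁ + σx - σy - t * Complex.I + s * Complex.I =
          b₁ + σx - σy + s * Complex.I - t * Complex.I by ring,
        show b₂ - σx + σy + t * Complex.I - s * Complex.I =
          b₂ - σx + σy - s * Complex.I + t * Complex.I by ring]
      ring
    simp_rw [e1]
    rw [integral_const_mul, h]
    generalize (t : ℂ) * Complex.I = t
    rw [show a₁ + σx + (a₂ - σx) = a₁ + a₂ by ring,
      show a₁ + σx + (b₂ - σx + σy + t) = a₁ + b₂ + σy + t by ring,
      show b₁ + σx - σy - t + (a₂ - σx) = a₂ + b₁ - σy - t by ring,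
      show b₁ + σx - σy - t + (b₂ - σx + σy + t) = b₁ + b₂ by ring,
      show a₁ + σx + (b₁ + σx - σy - t) + (a₂ - σx) + (b₂ - σx + σy + t) =
        a₁ + a₂ + b₁ + b₂ by ring,
      show a₁ + b₂ + σy + (c₁ + σy) + (d + σy) + (c₂ - σy) + (a₂ + b₁ - σy) + t =
        d + σy + (a₁ + a₂ + b₁ + b₂ + c₁ + c₂) + t by ring]
    ring
  have hB2 := MB.barnes2 (a := a₁ + b₂ + σy) (b := c₁ + σy) (c := d + σy) (d := c₂ - σy)
    (e := a₂ + b₁ - σy) (by simp; linarith) q5 q7 q6 (by simp; linarith)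
  rw [integral_congr_ae (Filter.Eventually.of_forall hFeq), Measure.volume_eq_prod,
    integral_prod_symm F hF]
  simp_rw [hx]
  rw [integral_const_mul, hB2]
  rw [show a₁ + b₂ + σy + (c₂ - σy) = a₁ + b₂ + c₂ by ring,
    show a₁ + b₂ + σy + (a₂ + b₁ - σy) = a₁ + a₂ + b₁ + b₂ by ring,
    show c₁ + σy + (c₂ - σy) = c₁ + c₂ by ring,
    show c₁ + σy + (a₂ + b₁ - σy) = a₂ + b₁ + c₁ by ring,
    show d + σy + (c₂ - σy) = c₂ + d by ring,
    show d + σy + (a₂ + b₁ - σy) = a₂ + b₁ + d by ring,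
    show a₁ + b₂ + σy + (c₁ + σy) + (c₂ - σy) + (a₂ + b₁ - σy) =
      a₁ + a₂ + b₁ + b₂ + c₁ + c₂ by ring,
    show a₁ + b₂ + σy + (d + σy) + (c₂ - σy) + (a₂ + b₁ - σy) =
      a₁ + a₂ + b₁ + b₂ + c₂ + d by ring,
    show c₁ + σy + (d + σy) + (c₂ - σy) + (a₂ + b₁ - σy) = a₂ + b₁ + c₁ + c₂ + d by ring]
  field_simp
end

section
/- Resummation of a Mellin–Barnes integral with a single family of left poles into a generalized hypergeometric series at argument −1: let n ≥ 2, let a₁, b₁, …, bₙ, c₁, …, c_{n−1} be complex numbers and σ a real number with −Re a₁ < σ < Re b_j for every j, Re(a₁ + b₁ + ⋯ + bₙ − c₁ − ⋯ − c_{n−1}) < 0, and such that a₁ + cₖ is not a nonpositive integer for each k. Then, writing z = σ + i·t, one has (1/(2π)) ∫_ℝ Γ(a₁+z)·∏_{j=1}^{n} Γ(b_j−z) / ∏_{k=1}^{n−1} Γ(cₖ−z) dt = [∏_{j=1}^{n} Γ(a₁+b_j) / ∏_{k=1}^{n−1} Γ(a₁+cₖ)] · Σ_{m=0}^{∞} (−1)^m/m!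 · ∏_{j=1}^{n} (a₁+b_j)ₘ / ∏_{k=1}^{n−1} (a₁+cₖ)ₘ, where the series on the right converges absolutely. -/
open MeasureTheory

local notation "Γ" => Complex.Gamma

/-- The ascending Pochhammer symbol `(x)ₘ = x(x+1)⋯(x+m−1)`. -/
noncomputable def poch (x : ℂ) (m : ℕ) : ℂ := ∏ k ∈ Finset.range m, (x + (k : ℂ))


namespace MBR
open Complex Filter Topology Set

lemma norm_beta_le (u v : ℂ) :
    ‖betaIntegral u v‖ ≤ ‖betaIntegral (u.re : ℂ) (v.re : ℂ)‖ := by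
  have key : betaIntegral (u.re : ℂ) (v.re : ℂ)
      = ((∫ x : ℝ in (0:ℝ)..1, x ^ (u.re - 1) * (1 - x) ^ (v.re - 1) : ℝ) : ℂ) := by
    rw [betaIntegral, ← intervalIntegral.integral_ofReal]
    apply intervalIntegral.integral_congr
    intro x hx
    rw [uIcc_of_le zero_le_one] at hx
    simp only
    rw [ofReal_mul, ofReal_cpow hx.1, ofReal_cpow (by linarith [hx.2])]
    push_cast
    rfl
  have h1 : ‖betaIntegral u v‖ ≤ ∫ x : ℝ in (0:ℝ)..1, x ^ (u.re - 1) * (1 - x) ^ (v.re - 1) := by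
    rw [betaIntegral]
    refine (intervalIntegral.norm_integral_le_integral_norm zero_le_one).trans (le_of_eq ?_)
    rw [intervalIntegral.integral_of_le zero_le_one, intervalIntegral.integral_of_le zero_le_one,
      integral_Ioc_eq_integral_Ioo, integral_Ioc_eq_integral_Ioo]
    refine setIntegral_congr_fun measurableSet_Ioo fun x hx => ?_
    rw [norm_mul, norm_cpow_eq_rpow_re_of_pos hx.1]
    have : (1 - (x:ℂ)) = ((1 - x : ℝ) : ℂ) := by push_cast; rfl
    rw [this, norm_cpow_eq_rpow_re_of_pos (by linarith [hx.2])]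
    simp
  rw [key, norm_real]
  exact h1.trans (le_abs_self _)

lemma norm_Gamma_div_le {u v : ℂ} (hu : 0 < u.re) (hv : 0 < v.re) :
    ‖Complex.Gamma u / Complex.Gamma (u + v)‖ ≤
      (Real.Gamma v.re / ‖Complex.Gamma v‖) * (Real.Gamma u.re / Real.Gamma (u.re + v.re)) := by
  have huv : Complex.Gamma (u + v) ≠ 0 := Gamma_ne_zero_of_re_pos (by rw [add_re]; linarith)
  have hv0 : Complex.Gamma v ≠ 0 := Gamma_ne_zero_of_re_pos hv
  have h := norm_beta_le u v
  rw [betaIntegral_eq_Gamma_mul_div u v hu hv, betaIntegral_eq_Gamma_mul_div _ _ (by simpa using hu) (by simpa using hv),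
    ← ofReal_add, Gamma_ofReal, Gamma_ofReal, Gamma_ofReal, ← ofReal_mul, ← ofReal_div, norm_real,
    Real.norm_of_nonneg (by
      have := Real.Gamma_pos_of_pos hu
      have := Real.Gamma_pos_of_pos hv
      have := Real.Gamma_pos_of_pos (add_pos hu hv)
      positivity)] at h
  have e : Complex.Gamma u / Complex.Gamma (u + v)
     = (Complex.Gamma u * Complex.Gamma v / Complex.Gamma (u + v)) / Complex.Gamma v := by
    field_simp
  rw [e, norm_div]
  have : 0 < ‖Complex.Gamma v‖ := norm_pos_iff.mpr hv0
  rw [div_le_iff₀ this]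
  refine h.trans (le_of_eq ?_)
  field_simp

lemma inv_Gamma_shift (s : ℂ) (k : ℕ) :
    (Complex.Gamma s)⁻¹ = (∏ i ∈ Finset.range k, (s + i)) * (Complex.Gamma (s + k))⁻¹ := by
  induction k with
  | zero => simp
  | succ k ih =>
    rw [ih, Finset.prod_range_succ, one_div_Gamma_eq_self_mul_one_div_Gamma_add_one (s + k)]
    push_cast
    rw [← add_assoc]; ring

lemma Gamma_shift (s : ℂ) (hs : ∀ m : ℕ, s ≠ -m) (k : ℕ) :
    Complex.Gamma (s + k) = (∏ i ∈ Finset.range k, (s + i)) * Complex.Gamma s := by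
  have h := inv_Gamma_shift s k
  have h1 : Complex.Gamma s ≠ 0 := Gamma_ne_zero hs
  have h2 : Complex.Gamma (s + k) ≠ 0 := by
    intro h2
    rw [h2] at h
    simp at h
    exact h1 h
  field_simp at h
  rw [h]; ring

lemma ratio_bound (B C : ℂ) : ∃ k : ℕ, ∃ K : ℝ, 0 ≤ K ∧ B.re < C.re + k ∧
    ∀ w : ℂ, w.re < B.re →
      ‖Complex.Gamma (B - w) / Complex.Gamma (C - w)‖ ≤
        K * (∏ i ∈ Finset.range k, ‖C - w + i‖) *
          (Real.Gamma (B.re - w.re) / Real.Gamma (C.re + k - w.re)) := by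
  obtain ⟨k, hk⟩ := exists_nat_gt (B.re - C.re)
  refine ⟨k, Real.Gamma (C + k - B).re / ‖Complex.Gamma (C + k - B)‖, ?_, by linarith, ?_⟩
  · have : 0 < (C + k - B).re := by simp; linarith
    have := Real.Gamma_pos_of_pos this
    positivity
  intro w hw
  have h1 : 0 < (C + k - B).re := by simp; linarith
  have h2 : 0 < (B - w).re := by simp; linarith
  have h := norm_Gamma_div_le h2 h1
  rw [div_eq_mul_inv, inv_Gamma_shift (C - w) k]
  have e : (B - w) + (C + k - B) = C - w + k := by ring
  have e2 : (B - w).re + (C + k - B).re = C.re + k - w.re := by simp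
  rw [e, e2] at h
  rw [show ∀ x y z : ℂ, x * (y * z) = y * (x * z) by intros; ring, norm_mul, norm_prod,
    ← div_eq_mul_inv]
  rw [mul_assoc, mul_left_comm]
  have e3 : (B - w).re = B.re - w.re := by simp
  rw [e3] at h
  gcongr

lemma line_int (d : ℝ) (hd : d ≠ 0) (T : ℝ) :
    ∫ t in (-T)..T, ((d : ℂ) + t * I)⁻¹ = ((2 * Real.arctan (T / d) : ℝ) : ℂ) := by
  have hne : ∀ t : ℝ, (d : ℂ) + t * I ≠ 0 := by
    intro t h
    apply hd
    simpa using congrArg Complex.re h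
  have hne' : ∀ t : ℝ, (d : ℂ) - t * I ≠ 0 := by
    intro t h
    apply hd
    simpa using congrArg Complex.re h
  have hc : Continuous fun t : ℝ => ((d : ℂ) + t * I)⁻¹ :=
    Continuous.inv₀ (by fun_prop) hne
  have hc' : Continuous fun t : ℝ => ((d : ℂ) - t * I)⁻¹ :=
    Continuous.inv₀ (by fun_prop) hne'
  have h1 : ∫ t in (-T)..T, ((d : ℂ) - t * I)⁻¹ = ∫ t in (-T)..T, ((d : ℂ) + t * I)⁻¹ := by
    have := intervalIntegral.integral_comp_neg (a := -T) (b := T) (fun t : ℝ => ((d : ℂ) + t * I)⁻¹)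
    simpa [sub_eq_add_neg] using this
  have h2 : ∫ t in (-T)..T, (((d : ℂ) + t * I)⁻¹ + ((d : ℂ) - t * I)⁻¹)
      = ∫ t in (-T)..T, ((2 * (d / (d ^ 2 + t ^ 2)) : ℝ) : ℂ) := by
    congr 1; ext t
    have := hne t; have := hne' t
    have h3 : (d : ℂ) ^ 2 + (t : ℂ) ^ 2 = (d + t * I) * (d - t * I) := by
      ring_nf; simp
    push_cast
    rw [h3]; field_simp; ring
  rw [intervalIntegral.integral_add (hc.intervalIntegrable _ _) (hc'.intervalIntegrable _ _), h1,
    intervalIntegral.integral_ofReal, intervalIntegral.integral_const_mul] at h2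
  have h4 : ∫ t in (-T)..T, d / (d ^ 2 + t ^ 2) = 2 * Real.arctan (T / d) := by
    have hd' : ∀ t : ℝ, d ^ 2 + t ^ 2 ≠ 0 := fun t => by positivity
    rw [intervalIntegral.integral_eq_sub_of_hasDerivAt (f := fun t => Real.arctan (t / d))]
    · rw [neg_div, Real.arctan_neg]; ring
    · intro t _
      have := ((hasDerivAt_id t).div_const d).arctan
      refine HasDerivAt.congr_deriv this ?_
      have := hd' t
      change 1 / (1 + (t / d) ^ 2) * (1 / d) = d / (d ^ 2 + t ^ 2)
      have h5 : 1 + (t / d) ^ 2 = (d ^ 2 + t ^ 2) / d ^ 2 := by field_simp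
      rw [h5]; field_simp
    · exact (Continuous.div continuous_const (by fun_prop) hd').intervalIntegrable _ _
  rw [h4] at h2
  push_cast at h2 ⊢
  linear_combination h2 / 2

lemma line_lim_pos (d : ℝ) (hd : 0 < d) :
    Tendsto (fun T : ℝ => ∫ t in (-T)..T, ((d : ℂ) + t * I)⁻¹) atTop (𝓝 (Real.pi : ℂ)) := by
  simp_rw [line_int d hd.ne']
  apply (continuous_ofReal.tendsto _).comp
  have h : Tendsto (fun T : ℝ => T / d) atTop atTop := tendsto_id.atTop_div_const hd
  have := ((Real.tendsto_arctan_atTop.mono_right nhdsWithin_le_nhds).comp h).const_mul 2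
  have e : ∀ a b : ℝ, a = b → 𝓝 a = 𝓝 b := fun a b h => by rw [h]
  exact this.trans (le_of_eq (e _ _ (by ring)))

lemma line_lim_neg (d : ℝ) (hd : d < 0) :
    Tendsto (fun T : ℝ => ∫ t in (-T)..T, ((d : ℂ) + t * I)⁻¹) atTop (𝓝 (-Real.pi : ℂ)) := by
  simp_rw [line_int d hd.ne]
  rw [← ofReal_neg]
  apply (continuous_ofReal.tendsto _).comp
  have h : Tendsto (fun T : ℝ => T / d) atTop atBot := tendsto_id.atTop_div_const_of_neg hd
  have := ((Real.tendsto_arctan_atBot.mono_right nhdsWithin_le_nhds).comp h).const_mul 2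
  have e : ∀ a b : ℝ, a = b → 𝓝 a = 𝓝 b := fun a b h => by rw [h]
  exact this.trans (le_of_eq (e _ _ (by ring)))

/-- shifting a contour across a simple pole -/
lemma shift (E F : ℂ → ℂ) (x₁ x₂ p : ℝ) (h1 : x₁ < p) (h2 : p < x₂) (U : Set ℂ) (hU : IsOpen U)
    (hUs : ∀ w : ℂ, x₁ ≤ w.re → w.re ≤ x₂ → w ∈ U) (hE : DifferentiableOn ℂ E U)
    (hF : ∀ w : ℂ, w ∈ U → w ≠ p → F w = E w / (w - p)) (K : ℝ)
    (hK : ∀ w : ℂ, x₁ ≤ w.re → w.re ≤ x₂ → 1 ≤ |w.im| → ‖F w‖ ≤ K * Real.exp (-|w.im|))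
    (hi1 : Integrable fun t : ℝ => F (x₁ + t * I)) (hi2 : Integrable fun t : ℝ => F (x₂ + t * I)) :
    ∫ t : ℝ, F (x₂ + t * I) = (∫ t : ℝ, F (x₁ + t * I)) + 2 * Real.pi * E p := by
  set f : ℂ → ℂ := dslope E p with hf
  have hpU : (p : ℂ) ∈ U := hUs _ (by simpa using h1.le) (by simpa using h2.le)
  have hfd : DifferentiableOn ℂ f U := (Complex.differentiableOn_dslope (hU.mem_nhds hpU)).2 hE
  have hfe : ∀ w : ℂ, w ∈ U → w ≠ p → f w = F w - E p * (w - p)⁻¹ := by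
    intro w hw hwp
    have : w - p ≠ 0 := sub_ne_zero.2 hwp
    rw [hf, dslope_of_ne _ hwp, slope_def_field, hF w hw hwp]
    field_simp
  have hlt := h1.trans h2
  -- vertical
  have vert : ∀ (x : ℝ), x₁ ≤ x → x ≤ x₂ → x ≠ p → Integrable (fun t : ℝ => F (x + t * I)) → ∀ T : ℝ,
      ∫ t in (-T)..T, f (x + t * I) = (∫ t in (-T)..T, F (x + t * I))
        - E p * ∫ t in (-T)..T, (((x - p : ℝ) : ℂ) + t * I)⁻¹ := by
    intro x ha hb hx hi T
    rw [← intervalIntegral.integral_const_mul, ← intervalIntegral.integral_sub hi.intervalIntegrable]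
    · congr 1; ext t
      rw [hfe]
      · push_cast; ring_nf
      · apply hUs <;> simpa
      · intro h; apply hx; simpa using congrArg Complex.re h
    · apply Continuous.intervalIntegrable
      apply continuous_const.mul
      apply Continuous.inv₀ (by fun_prop)
      intro t h
      apply hx
      have := congrArg Complex.re h
      simp at this
      linarith
  -- horizontal
  have hor : ∀ s : ℝ, |s| = 1 → Tendsto (fun T : ℝ => ∫ x in x₁..x₂, f (x + (s * T : ℝ) * I)) atTop (𝓝 0) := by
    intro s hs
    have hb : Tendsto (fun T : ℝ => (K * Real.exp (-T) + ‖E p‖ * T⁻¹) * |x₂ - x₁|) atTop (𝓝 0) := by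
      have a1 : Tendsto (fun T : ℝ => Real.exp (-T)) atTop (𝓝 0) := Real.tendsto_exp_neg_atTop_nhds_zero
      have a2 : Tendsto (fun T : ℝ => T⁻¹) atTop (𝓝 0) := tendsto_inv_atTop_zero
      simpa using ((a1.const_mul K).add (a2.const_mul ‖E p‖)).mul_const |x₂ - x₁|
    apply squeeze_zero_norm' _ hb
    filter_upwards [eventually_ge_atTop 1] with T hT
    apply intervalIntegral.norm_integral_le_of_norm_le_const
    intro x hx
    rw [uIoc_of_le hlt.le] at hx
    have him : |((x:ℂ) + (s * T : ℝ) * I).im| = T := by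
      simp [abs_mul, hs, abs_of_nonneg (by linarith : 0 ≤ T)]
    have hre : ((x:ℂ) + (s * T : ℝ) * I).re = x := by simp
    rw [hfe]
    · refine (norm_sub_le _ _).trans ?_
      rw [norm_mul]
      gcongr
      · have := hK _ (by rw [hre]; exact hx.1.le) (by rw [hre]; exact hx.2) (by rw [him]; exact hT)
        rwa [him] at this
      · rw [norm_inv]
        have : T ≤ ‖(x:ℂ) + (s * T : ℝ) * I - p‖ := by
          refine le_trans (le_of_eq ?_) (abs_im_le_norm _)
          rw [sub_im, ofReal_im, sub_zero, him]
        gcongr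
    · apply hUs
      · rw [hre]; exact hx.1.le
      · rw [hre]; exact hx.2
    · intro h
      rw [h] at him
      simp at him
      linarith
  have rect : ∀ T : ℝ, (∫ x in x₁..x₂, f (x + ((-1) * T : ℝ) * I)) - (∫ x in x₁..x₂, f (x + (1 * T : ℝ) * I))
      + I * (∫ t in (-T)..T, f (x₂ + t * I)) - I * (∫ t in (-T)..T, f (x₁ + t * I)) = 0 := by
    intro T
    have := Complex.integral_boundary_rect_eq_zero_of_differentiableOn f (⟨x₁, -T⟩) (⟨x₂, T⟩)
      (hfd.mono (by
        intro w hw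
        rw [mem_reProdIm] at hw
        simp only [uIcc_of_le hlt.le] at hw
        exact hUs w hw.1.1 hw.1.2))
    simpa using this
  have L1 := intervalIntegral_tendsto_integral hi1 tendsto_neg_atTop_atBot tendsto_id
  have L2 := intervalIntegral_tendsto_integral hi2 tendsto_neg_atTop_atBot tendsto_id
  simp only [id] at L1 L2
  have M1 := line_lim_neg (x₁ - p) (by linarith)
  have M2 := line_lim_pos (x₂ - p) (by linarith)
  have lim := (((hor (-1) (by simp)).sub (hor 1 (by simp))).add ((L2.sub (M2.const_mul (E p))).const_mul I)).sub
    ((L1.sub (M1.const_mul (E p))).const_mul I)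
  have := tendsto_nhds_unique (lim.congr (fun T => by
    rw [← vert x₂ hlt.le le_rfl h2.ne' hi2 T, ← vert x₁ le_rfl hlt.le h1.ne hi1 T]
    exact rect T)) tendsto_const_nhds
  have h3 : I * ((∫ t : ℝ, F (x₂ + t * I)) - ((∫ t : ℝ, F (x₁ + t * I)) + 2 * Real.pi * E p)) = 0 := by
    linear_combination this
  have := (mul_eq_zero.1 h3).resolve_left I_ne_zero
  exact sub_eq_zero.1 this

end MBR

namespace MBR
open Complex Filter Topology Set

lemma prod_bound {α ι : Type*} [Fintype ι] (S : Set α) (f ρ : ι → α → ℝ) (u : α → ℝ)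
    (hf : ∀ j a, 0 ≤ f j a)
    (h : ∀ j, ∃ K : ℝ, 0 ≤ K ∧ ∃ M : ℕ, ∀ a ∈ S, f j a ≤ K * ρ j a * u a ^ M) :
    ∃ K : ℝ, 0 ≤ K ∧ ∃ M : ℕ, ∀ a ∈ S, ∏ j, f j a ≤ K * (∏ j, ρ j a) * u a ^ M := by
  choose K hK M hM using h
  refine ⟨∏ j, K j, Finset.prod_nonneg fun j _ => hK j, ∑ j, M j, fun a ha => ?_⟩
  refine (Finset.prod_le_prod (fun j _ => hf j a) (fun j _ => hM j a ha)).trans (le_of_eq ?_)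
  rw [Finset.prod_mul_distrib, Finset.prod_mul_distrib, Finset.prod_pow_eq_pow_sum]

lemma norm_shift_le (C w : ℂ) (i k : ℕ) (hi : i < k) (R : ℝ) (hR : 1 ≤ R) (hw : |w.re| ≤ R) :
    ‖C - w + i‖ ≤ (‖C‖ + 1 + k) * R * (1 + |w.im|) := by
  have h1 : ‖C - w + i‖ ≤ ‖C‖ + (|w.re| + |w.im|) + i := by
    refine (norm_add_le _ _).trans ?_
    rw [norm_natCast]
    gcongr
    exact (norm_sub_le _ _).trans (by gcongr; exact norm_le_abs_re_add_abs_im w)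
  have h2 : (i : ℝ) ≤ k := by exact_mod_cast hi.le
  have h3 := norm_nonneg C
  have h4 := abs_nonneg w.im
  have h5 : (0:ℝ) ≤ k := by positivity
  have h6 : (‖C‖ + 1 + k) * R * (1 + |w.im|) = ‖C‖ * (R * (1 + |w.im|)) + R + R * |w.im| + k * (R * (1 + |w.im|)) := by ring
  have h7 : 1 ≤ R * (1 + |w.im|) := by nlinarith
  rw [h6]
  nlinarith

lemma prod_shift_le (C w : ℂ) (k : ℕ) (R : ℝ) (hR : 1 ≤ R) (hw : |w.re| ≤ R) :
    ∏ i ∈ Finset.range k, ‖C - w + i‖ ≤ ((‖C‖ + 1 + k) * R * (1 + |w.im|)) ^ k := by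
  refine (Finset.prod_le_prod (fun i _ => norm_nonneg _)
    (fun i hi => norm_shift_le C w i k (Finset.mem_range.1 hi) R hR hw)).trans (le_of_eq ?_)
  simp

lemma strip_bound (B C : ℂ) (x₁ x₂ : ℝ) (hx : x₂ < B.re) :
    ∃ K : ℝ, 0 ≤ K ∧ ∃ M : ℕ, ∀ w ∈ {w : ℂ | x₁ ≤ w.re ∧ w.re ≤ x₂},
      ‖Complex.Gamma (B - w) / Complex.Gamma (C - w)‖ ≤ K * 1 * (1 + |w.im|) ^ M := by
  obtain ⟨k, K, hK, hk, h⟩ := ratio_bound B C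
  have hcont : ContinuousOn (fun x : ℝ => Real.Gamma (B.re - x) / Real.Gamma (C.re + k - x)) (Icc x₁ x₂) := by
    have aux : ∀ γ : ℝ, x₂ < γ → ContinuousOn (fun x : ℝ => Real.Gamma (γ - x)) (Icc x₁ x₂) := by
      intro γ hγ x hx
      apply ContinuousAt.continuousWithinAt
      have h0 : 0 < γ - x := by linarith [hx.2]
      have : ContinuousAt Real.Gamma (γ - x) := (Real.differentiableAt_Gamma (fun m => by
        have : (0:ℝ) ≤ m := by positivity
        linarith)).continuousAt
      exact ContinuousAt.comp (f := fun x => γ - x) this (by fun_prop)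
    apply ContinuousOn.div (aux _ hx) (aux _ (by linarith))
    intro x hx
    exact (Real.Gamma_pos_of_pos (by linarith [hx.2])).ne'
  obtain ⟨D, hD⟩ := isCompact_Icc.exists_bound_of_continuousOn hcont
  set R := 1 + |x₁| + |x₂| with hR
  refine ⟨K * ((‖C‖ + 1 + k) * R) ^ k * |D|, by positivity, k, fun w hw => ?_⟩
  have hwR : |w.re| ≤ R := by
    rw [abs_le]
    constructor
    · linarith [hw.1, neg_abs_le x₁, abs_nonneg x₂]
    · linarith [hw.2, le_abs_self x₂, abs_nonneg x₁]
  have hR1 : 1 ≤ R := by linarith [abs_nonneg x₁, abs_nonneg x₂]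
  have hprod : ∏ i ∈ Finset.range k, ‖C - w + i‖ ≤ ((‖C‖ + 1 + k) * R * (1 + |w.im|)) ^ k := by
    exact prod_shift_le C w k R hR1 hwR
  have hD' := (le_abs_self _).trans ((hD w.re ⟨hw.1, hw.2⟩).trans (le_abs_self D))
  refine (h w (hw.2.trans_lt hx)).trans ?_
  have hp : 0 ≤ Real.Gamma (B.re - w.re) / Real.Gamma (C.re + k - w.re) := by
    have := Real.Gamma_pos_of_pos (by linarith [hw.2] : 0 < B.re - w.re)
    have := Real.Gamma_pos_of_pos (by linarith [hw.2] : 0 < C.re + k - w.re)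
    positivity
  calc _ ≤ K * ((‖C‖ + 1 + k) * R * (1 + |w.im|)) ^ k * |D| := by gcongr
    _ = _ := by rw [mul_pow]; ring

lemma real_Gamma_shift (s : ℝ) (hs : 0 < s) (k : ℕ) :
    Real.Gamma (s + k) = (∏ i ∈ Finset.range k, (s + i)) * Real.Gamma s := by
  induction k with
  | zero => simp
  | succ k ih =>
    rw [Finset.prod_range_succ]
    push_cast
    rw [← add_assoc, Real.Gamma_add_one (by positivity), ih]
    ring

lemma gammaRatio (y y' : ℝ) (hy : 0 < y) (hy' : 0 < y') :
    ∃ K : ℝ, 0 ≤ K ∧ ∀ N : ℕ, 1 ≤ N →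
      Real.Gamma (y + (N + 1 : ℕ)) / Real.Gamma (y' + (N + 1 : ℕ)) ≤ K * (N : ℝ) ^ (y - y') := by
  have g := Real.Gamma_pos_of_pos hy
  have g' := Real.Gamma_pos_of_pos hy'
  have lim : Tendsto (fun N => Real.GammaSeq y' N / Real.GammaSeq y N) atTop (𝓝 (Real.Gamma y' / Real.Gamma y)) :=
    (Real.GammaSeq_tendsto_Gamma y').div (Real.GammaSeq_tendsto_Gamma y) g.ne'
  obtain ⟨D, hD⟩ := lim.bddAbove_range
  refine ⟨(Real.Gamma y / Real.Gamma y') * |D|, by positivity, fun N hN => ?_⟩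
  have hN0 : (0:ℝ) < N := by exact_mod_cast hN
  have h1 : Real.GammaSeq y' N / Real.GammaSeq y N ≤ |D| := (hD (mem_range_self N)).trans (le_abs_self D)
  have p1 : 0 < ∏ i ∈ Finset.range (N + 1), (y + i) := Finset.prod_pos fun i _ => by positivity
  have p2 : 0 < ∏ i ∈ Finset.range (N + 1), (y' + i) := Finset.prod_pos fun i _ => by positivity
  rw [real_Gamma_shift y hy, real_Gamma_shift y' hy']
  have e : (∏ i ∈ Finset.range (N + 1), (y + i)) * Real.Gamma y / ((∏ i ∈ Finset.range (N + 1), (y' + i)) * Real.Gamma y')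
      = Real.Gamma y / Real.Gamma y' * (Real.GammaSeq y' N / Real.GammaSeq y N) * (N : ℝ) ^ (y - y') := by
    rw [Real.GammaSeq, Real.GammaSeq, Real.rpow_sub hN0]
    have := Real.rpow_pos_of_pos hN0 y
    have := Real.rpow_pos_of_pos hN0 y'
    have : (0:ℝ) < N.factorial := by positivity
    field_simp
  rw [e]
  gcongr

lemma far_bound (B C : ℂ) (θ : ℝ) (hB : 0 < B.re) (hθ : 0 ≤ θ) :
    ∃ K : ℝ, 0 ≤ K ∧ ∃ M : ℕ, ∀ q ∈ {q : ℕ × ℝ | 1 ≤ q.1},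
      ‖Complex.Gamma (B - ((-(q.1 + 1 + θ) : ℝ) + q.2 * I)) /
        Complex.Gamma (C - ((-(q.1 + 1 + θ) : ℝ) + q.2 * I))‖ ≤
        K * (q.1 : ℝ) ^ (B.re - C.re) * (1 + |q.2|) ^ M := by
  obtain ⟨k, K, hK, hk, h⟩ := ratio_bound B C
  obtain ⟨D, hD, hD'⟩ := gammaRatio (B.re + θ) (C.re + k + θ) (by linarith) (by linarith)
  refine ⟨K * ((‖C‖ + 1 + k) * (2 + θ)) ^ k * D, by positivity, k, ?_⟩
  rintro ⟨N, t⟩ hN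
  simp only [mem_ofPred_eq] at hN ⊢
  have hN1 : (1:ℝ) ≤ N := by exact_mod_cast hN
  have hN0 : (0:ℝ) < N := by linarith
  set w : ℂ := ((-(N + 1 + θ) : ℝ) + t * I) with hw
  have hre : w.re = -(N + 1 + θ) := by simp [hw]
  have him : w.im = t := by simp [hw]
  have hprod : ∏ i ∈ Finset.range k, ‖C - w + i‖ ≤ ((‖C‖ + 1 + k) * ((2 + θ) * N) * (1 + |w.im|)) ^ k := by
    refine prod_shift_le C w k _ (by nlinarith) ?_
    rw [hre, abs_neg, abs_of_nonneg (by positivity)]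
    nlinarith
  have h1 := h w (by rw [hre]; linarith)
  have h2 := hD' N hN
  have e1 : B.re - w.re = B.re + θ + (N + 1 : ℕ) := by rw [hre]; push_cast; ring
  have e2 : C.re + k - w.re = C.re + k + θ + (N + 1 : ℕ) := by rw [hre]; push_cast; ring
  rw [e1, e2] at h1
  refine h1.trans ?_
  have hp : 0 ≤ Real.Gamma (B.re + θ + (N + 1 : ℕ)) / Real.Gamma (C.re + k + θ + (N + 1 : ℕ)) := by
    have := Real.Gamma_pos_of_pos (by positivity : 0 < B.re + θ + (N + 1 : ℕ))
    have := Real.Gamma_pos_of_pos (by push_cast; linarith : 0 < C.re + k + θ + (N + 1 : ℕ))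
    positivity
  calc _ ≤ K * ((‖C‖ + 1 + k) * ((2 + θ) * N) * (1 + |w.im|)) ^ k * (D * (N : ℝ) ^ (B.re + θ - (C.re + k + θ))) := by
        gcongr
    _ = _ := by
        have : (N : ℝ) ^ (B.re - C.re) = (N : ℝ) ^ (B.re + θ - (C.re + k + θ)) * (N : ℝ) ^ k := by
          rw [← Real.rpow_natCast, ← Real.rpow_add hN0]
          congr 1; ring
        rw [this, him]
        simp only [mul_pow]
        ring

lemma sinh_le_norm_sin (w : ℂ) : |Real.sinh w.im| ≤ ‖Complex.sin w‖ := by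
  have h : Complex.sin w = (Complex.exp (-w * I) - Complex.exp (w * I)) * I / 2 := rfl
  have h2 := abs_norm_sub_norm_le (Complex.exp (-w * I)) (Complex.exp (w * I))
  rw [norm_exp, norm_exp] at h2
  simp only [neg_mul, neg_re, mul_re, I_re, I_im, mul_zero, mul_one, zero_sub, neg_neg] at h2
  rw [h, norm_div, norm_mul, norm_I, mul_one, Real.sinh_eq, abs_div]
  simp only [neg_mul] at h2 ⊢
  norm_num
  linarith

lemma sin_lower (w : ℂ) (hw : 1 ≤ |w.im|) :
    Real.exp (Real.pi * |w.im|) / 4 ≤ ‖Complex.sin (Real.pi * w)‖ := by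
  refine le_trans ?_ (sinh_le_norm_sin _)
  have e : ((Real.pi : ℂ) * w).im = Real.pi * w.im := by simp
  rw [e, Real.abs_sinh, abs_mul, abs_of_pos Real.pi_pos] 
  set y := Real.pi * |w.im|
  have hy : 1 ≤ y := by nlinarith [Real.pi_gt_three]
  rw [Real.sinh_eq]
  have h1 : 2 ≤ Real.exp y := by linarith [Real.add_one_le_exp y]
  have h2 : Real.exp (-y) ≤ 1 := Real.exp_le_one_iff.2 (by linarith)
  linarith

lemma sin_lower_half (N : ℕ) (t : ℝ) :
    Real.exp (Real.pi * |t|) / 4 ≤ ‖Complex.sin (Real.pi * ((-(N + 1 + 1 / 2 : ℝ) : ℝ) + t * I))‖ := by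
  set w : ℂ := Real.pi * ((-(N + 1 + 1 / 2 : ℝ) : ℝ) + t * I) with hw
  have hre : w.re = Real.pi * (-(N + 1 + 1 / 2)) := by simp [hw]
  have him : w.im = Real.pi * t := by simp [hw]
  have hc : Real.cos w.re = 0 := by
    rw [Real.cos_eq_zero_iff]
    refine ⟨-(N + 2), ?_⟩
    rw [hre]; push_cast; ring
  have hs : |Real.sin w.re| = 1 := by
    have := Real.sin_sq_add_cos_sq w.re
    rw [hc] at this
    rw [← sq_eq_sq₀ (abs_nonneg _) zero_le_one, sq_abs]
    linarith
  have h : (Complex.sin w).re = Real.sin w.re * Real.cosh w.im := by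
    rw [Complex.sin_eq, ← ofReal_sin, ← ofReal_cos, ← ofReal_cosh, ← ofReal_sinh]
    simp
    exact Or.inl (sin_ofReal_re _)
  refine le_trans ?_ (abs_re_le_norm _)
  rw [h, abs_mul, hs, one_mul, abs_of_pos (Real.cosh_pos _), him, ← Real.cosh_abs, abs_mul, abs_of_pos Real.pi_pos,
    Real.cosh_eq]
  have := Real.exp_pos (Real.pi * |t|)
  have := Real.exp_pos (-(Real.pi * |t|))
  linarith

lemma pow_le_exp (M : ℕ) (u : ℝ) (hu : 0 ≤ u) : (1 + u) ^ M ≤ M.factorial * Real.exp 1 * Real.exp u := by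
  have h := Real.pow_div_factorial_le_exp (x := 1 + u) (by linarith) M
  rw [div_le_iff₀ (by positivity), Real.exp_add] at h
  linarith

lemma final_bound (K : ℝ) (hK : 0 ≤ K) (M : ℕ) (u r S : ℝ) (hu : 0 ≤ u)
    (hS : Real.exp (Real.pi * u) / 4 ≤ S) (hr : r ≤ K * (1 + u) ^ M) :
    Real.pi / S * r ≤ K * (4 * Real.pi * (M.factorial * Real.exp 1)) * Real.exp (-u) := by
  have hpi := Real.pi_gt_three
  have hS0 : 0 < S := lt_of_lt_of_le (by positivity) hS
  have h1 : (1 + u) ^ M ≤ M.factorial * Real.exp 1 * Real.exp u := pow_le_exp M u hu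
  have h2 : Real.exp u ≤ 4 * S * Real.exp (-u) := by
    have : Real.exp u = Real.exp (2 * u) * Real.exp (-u) := by rw [← Real.exp_add]; ring_nf
    rw [this]
    gcongr
    have : Real.exp (2 * u) ≤ Real.exp (Real.pi * u) := by
      gcongr; linarith
    linarith
  rw [div_mul_eq_mul_div, div_le_iff₀ hS0]
  calc Real.pi * r ≤ Real.pi * (K * (M.factorial * Real.exp 1 * (4 * S * Real.exp (-u)))) := by
        gcongr
        refine hr.trans ?_
        gcongr
        refine h1.trans ?_
        gcongr
    _ = _ := by ring

end MBR

namespace MBR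
open Complex Filter Topology Set

noncomputable def G {n : ℕ} (B : Fin (n + 1) → ℂ) (C : Fin n → ℂ) (w : ℂ) : ℂ :=
  (∏ j, Complex.Gamma (B j - w)) / ∏ k, Complex.Gamma (C k - w)

noncomputable def F {n : ℕ} (B : Fin (n + 1) → ℂ) (C : Fin n → ℂ) (w : ℂ) : ℂ :=
  Complex.Gamma w * G B C w

noncomputable def C1 {n : ℕ} (C : Fin n → ℂ) : Fin (n + 1) → ℂ := Fin.cons 1 C

noncomputable def H {n : ℕ} (B : Fin (n + 1) → ℂ) (C : Fin n → ℂ) (w : ℂ) : ℂ :=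
  ∏ j, (Complex.Gamma (B j - w) / Complex.Gamma (C1 C j - w))

lemma G_eq {n : ℕ} (B : Fin (n + 1) → ℂ) (C : Fin n → ℂ) (w : ℂ)
    (hw : Complex.Gamma (1 - w) ≠ 0) : G B C w = Complex.Gamma (1 - w) * H B C w := by
  rw [G, H, Finset.prod_div_distrib, Fin.prod_univ_succ (fun j => Complex.Gamma (C1 C j - w))]
  simp only [C1, Fin.cons_zero, Fin.cons_succ]
  field_simp

lemma F_norm {n : ℕ} (B : Fin (n + 1) → ℂ) (C : Fin n → ℂ) (w : ℂ)
    (hw : Complex.Gamma (1 - w) ≠ 0) :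
    ‖F B C w‖ = Real.pi / ‖Complex.sin (Real.pi * w)‖ * ‖H B C w‖ := by
  rw [F, G_eq B C w hw, ← mul_assoc, Gamma_mul_Gamma_one_sub, norm_mul, norm_div, norm_real,
    Real.norm_of_nonneg Real.pi_pos.le]

lemma one_sub_ne {w : ℂ} (hw : w.re < 1 ∨ w.im ≠ 0) : Complex.Gamma (1 - w) ≠ 0 := by
  apply Gamma_ne_zero
  intro m h
  rcases hw with hw | hw
  · have := congrArg Complex.re h
    simp at this
    have : (0:ℝ) ≤ m := by positivity
    linarith
  · have := congrArg Complex.im h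
    simp at this
    exact hw this

lemma F_strip {n : ℕ} (B : Fin (n + 1) → ℂ) (C : Fin n → ℂ) (x₁ x₂ : ℝ) (hx : ∀ j, x₂ < (B j).re) :
    ∃ K : ℝ, 0 ≤ K ∧ ∀ w : ℂ, x₁ ≤ w.re → w.re ≤ x₂ → 1 ≤ |w.im| →
      ‖F B C w‖ ≤ K * Real.exp (-|w.im|) := by
  obtain ⟨K, hK, M, h⟩ := prod_bound {w : ℂ | x₁ ≤ w.re ∧ w.re ≤ x₂}
    (fun j w => ‖Complex.Gamma (B j - w) / Complex.Gamma (C1 C j - w)‖) (fun _ _ => 1)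
    (fun w => 1 + |w.im|) (fun _ _ => norm_nonneg _) (fun j => strip_bound (B j) (C1 C j) x₁ x₂ (hx j))
  refine ⟨K * (4 * Real.pi * (M.factorial * Real.exp 1)), by have := Real.pi_pos; positivity,
    fun w h1 h2 h3 => ?_⟩
  have h4 := h w ⟨h1, h2⟩
  simp only [Finset.prod_const_one, mul_one] at h4
  rw [F_norm _ _ _ (one_sub_ne (Or.inr (by intro h0; rw [h0] at h3; norm_num at h3)))]
  apply final_bound K hK M _ _ _ (abs_nonneg _) (sin_lower w h3)
  rwa [H, norm_prod]

lemma H_far {n : ℕ} (B : Fin (n + 1) → ℂ) (C : Fin n → ℂ) (hB : ∀ j, 0 < (B j).re) (θ : ℝ) (hθ : 0 ≤ θ) :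
    ∃ K : ℝ, 0 ≤ K ∧ ∃ M : ℕ, ∀ (N : ℕ) (t : ℝ), 1 ≤ N →
      ‖H B C ((-(N + 1 + θ) : ℝ) + t * I)‖ ≤
        K * (N : ℝ) ^ (∑ j, ((B j).re - (C1 C j).re)) * (1 + |t|) ^ M := by
  obtain ⟨K, hK, M, h⟩ := prod_bound {q : ℕ × ℝ | 1 ≤ q.1}
    (fun j q => ‖Complex.Gamma (B j - ((-(q.1 + 1 + θ) : ℝ) + q.2 * I)) /
        Complex.Gamma (C1 C j - ((-(q.1 + 1 + θ) : ℝ) + q.2 * I))‖)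
    (fun j q => (q.1 : ℝ) ^ ((B j).re - (C1 C j).re))
    (fun q => 1 + |q.2|) (fun _ _ => norm_nonneg _) (fun j => far_bound (B j) (C1 C j) θ (hB j) hθ)
  refine ⟨K, hK, M, fun N t hN => ?_⟩
  have := h (N, t) hN
  simp only at this
  rw [H, norm_prod, Real.rpow_sum_of_pos (by exact_mod_cast hN)]
  exact this

lemma F_far {n : ℕ} (B : Fin (n + 1) → ℂ) (C : Fin n → ℂ) (hB : ∀ j, 0 < (B j).re) :
    ∃ K : ℝ, 0 ≤ K ∧ ∀ (N : ℕ) (t : ℝ), 1 ≤ N →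
      ‖F B C ((-(N + 1 + 1 / 2 : ℝ) : ℝ) + t * I)‖ ≤
        K * (N : ℝ) ^ (∑ j, ((B j).re - (C1 C j).re)) * Real.exp (-|t|) := by
  obtain ⟨K, hK, M, h⟩ := H_far B C hB (1 / 2) (by norm_num)
  refine ⟨K * (4 * Real.pi * (M.factorial * Real.exp 1)), by have := Real.pi_pos; positivity,
    fun N t hN => ?_⟩
  rw [F_norm _ _ _ (one_sub_ne (Or.inl (by simp; linarith [(Nat.cast_nonneg N : (0:ℝ) ≤ N)])))]
  refine (final_bound _ (by positivity) M _ _ _ (abs_nonneg t) (sin_lower_half N t) (h N t hN)).trans (le_of_eq ?_)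
  ring

lemma exp_le_inv (t : ℝ) : Real.exp (-|t|) ≤ 2 * (1 + t ^ 2)⁻¹ := by
  have h := Real.quadratic_le_exp_of_nonneg (abs_nonneg t)
  rw [sq_abs] at h
  rw [Real.exp_neg, ← div_eq_mul_inv, inv_le_comm₀ (Real.exp_pos _) (by positivity), inv_div]
  linarith [abs_nonneg t]

lemma G_diff {n : ℕ} (B : Fin (n + 1) → ℂ) (C : Fin n → ℂ) (w : ℂ) (hw : ∀ j, w.re < (B j).re) :
    DifferentiableAt ℂ (G B C) w := by
  have : G B C = fun w => (∏ j, Complex.Gamma (B j - w)) * ∏ k, (Complex.Gamma (C k - w))⁻¹ := by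
    ext w; rw [G, div_eq_mul_inv, Finset.prod_inv_distrib]
  rw [this]
  apply DifferentiableAt.mul
  · apply DifferentiableAt.fun_finsetProd
    intro j _
    have h0 : DifferentiableAt ℂ Complex.Gamma (B j - w) := by
      apply differentiableAt_Gamma
      intro m h
      have := congrArg Complex.re h
      simp at this
      have : (0:ℝ) ≤ m := by positivity
      linarith [hw j]
    exact DifferentiableAt.comp (f := fun w => B j - w) w h0 (by fun_prop)
  · apply DifferentiableAt.fun_finsetProd
    intro k _
    exact DifferentiableAt.comp (f := fun w => C k - w) (g := fun s => (Complex.Gamma s)⁻¹) w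
      (differentiable_one_div_Gamma _) (by fun_prop)

lemma F_integrable {n : ℕ} (B : Fin (n + 1) → ℂ) (C : Fin n → ℂ) (x : ℝ) (hx : ∀ j, x < (B j).re)
    (hx' : ∀ m : ℕ, x ≠ -m) : Integrable (fun t : ℝ => F B C (x + t * I)) := by
  have hc : Continuous (fun t : ℝ => F B C (x + t * I)) := by
    rw [continuous_iff_continuousAt]
    intro t
    have h1 : DifferentiableAt ℂ (F B C) (x + t * I) := by
      apply DifferentiableAt.mul
      · apply differentiableAt_Gamma
        intro m h
        have := congrArg Complex.re h
        simp at this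
        exact hx' m this
      · apply G_diff
        simpa using hx
    exact ContinuousAt.comp (f := fun t : ℝ => (x + t * I : ℂ)) h1.continuousAt (by fun_prop)
  obtain ⟨K, hK, h⟩ := F_strip B C x x hx
  obtain ⟨D, hD⟩ := (isCompact_Icc (a := (-1:ℝ)) (b := 1)).exists_bound_of_continuousOn hc.continuousOn
  refine Integrable.mono' (g := fun t => 2 * (K + |D|) * (1 + t ^ 2)⁻¹) (integrable_inv_one_add_sq.const_mul _)
    hc.aestronglyMeasurable (Eventually.of_forall fun t => ?_)
  have hp : (0:ℝ) < (1 + t ^ 2)⁻¹ := by positivity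
  have hd := abs_nonneg D
  by_cases ht : |t| ≤ 1
  · have h1 := (hD t (abs_le.1 ht)).trans (le_abs_self D)
    have h2 : (1:ℝ) ≤ 2 * (1 + t ^ 2)⁻¹ := by
      rw [← div_eq_mul_inv, le_div_iff₀ (by positivity)]
      nlinarith [sq_abs t, abs_nonneg t]
    nlinarith
  · have h1 := h (x + t * I) (by simp) (by simp) (by simpa using (not_le.1 ht).le)
    have e : ((x:ℂ) + t * I).im = t := by simp
    rw [e] at h1
    have h2 := exp_le_inv t
    nlinarith

noncomputable def E {n : ℕ} (B : Fin (n + 1) → ℂ) (C : Fin n → ℂ) (m : ℕ) (w : ℂ) : ℂ :=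
  Complex.Gamma (w + (m + 1 : ℕ)) * G B C w * (∏ i ∈ Finset.range m, (w + i))⁻¹

lemma step {n : ℕ} (B : Fin (n + 1) → ℂ) (C : Fin n → ℂ) (m : ℕ) (x : ℝ) (hx : ∀ j, x < (B j).re)
    (hxm : -(m:ℝ) < x) (hxm' : m = 0 ∨ x < -(m:ℝ) + 1) (hx' : ∀ m : ℕ, x ≠ -m) :
    ∫ t : ℝ, F B C (x + t * I) = (∫ t : ℝ, F B C ((-(m + 1 / 2) : ℝ) + t * I))
      + 2 * Real.pi * E B C m (-m : ℝ) := by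
  obtain ⟨K, -, hK⟩ := F_strip B C (-(m + 1 / 2)) x hx
  have hhalf : ∀ k : ℕ, (-(m + 1 / 2) : ℝ) ≠ -k := by
    intro k h
    have h1 : (2 * m + 1 : ℝ) = 2 * k := by linarith
    have h2 : 2 * m + 1 = 2 * k := by exact_mod_cast h1
    omega
  have hi1 := F_integrable B C (-(m + 1 / 2)) (fun j => by linarith [hx j]) hhalf
  have hi2 := F_integrable B C x hx hx'
  refine shift (E B C m) (F B C) (-(m + 1 / 2)) x (-m) (by linarith) hxm
    ({w : ℂ | -(m:ℝ) - 1 < w.re} ∩ (⋂ j, {w : ℂ | w.re < (B j).re}) ∩ {w : ℂ | m = 0 ∨ w.re < -(m:ℝ) + 1})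
    ?_ ?_ ?_ ?_ K hK hi1 hi2
  · refine (IsOpen.inter ?_ ?_).inter ?_
    · exact isOpen_lt continuous_const continuous_re
    · exact isOpen_iInter_of_finite fun j => isOpen_lt continuous_re continuous_const
    · rcases eq_or_ne m 0 with h | h
      · simp [h]
      · simp only [h, false_or]
        exact isOpen_lt continuous_re continuous_const
  · intro w h1 h2
    refine ⟨⟨?_, mem_iInter.2 fun j => ?_⟩, ?_⟩
    · change -(m:ℝ) - 1 < w.re
      linarith
    · exact h2.trans_lt (hx j)
    · exact hxm'.imp id (fun h => h2.trans_lt h)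
  · rintro w ⟨⟨h1, h2⟩, h3⟩
    apply DifferentiableAt.differentiableWithinAt
    change -(m:ℝ) - 1 < w.re at h1
    have h2' : ∀ j, w.re < (B j).re := fun j => mem_iInter.1 h2 j
    apply DifferentiableAt.mul
    · apply DifferentiableAt.mul _ (G_diff B C w h2')
      have h0 : DifferentiableAt ℂ Complex.Gamma (w + (m + 1 : ℕ)) := by
        apply differentiableAt_Gamma
        intro k h
        have := congrArg Complex.re h
        simp at this
        have : (0:ℝ) ≤ k := by positivity
        linarith
      exact DifferentiableAt.comp (f := fun w => w + ((m + 1 : ℕ) : ℂ)) w h0 (by fun_prop)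
    · apply DifferentiableAt.inv
      · apply DifferentiableAt.fun_finsetProd
        intro i _
        fun_prop
      · rw [Finset.prod_ne_zero_iff]
        intro i hi h
        have hi := Finset.mem_range.1 hi
        have h3 : w.re < -(m:ℝ) + 1 := Or.resolve_left h3 (by omega)
        have := congrArg Complex.re h
        simp at this
        have : (i:ℝ) + 1 ≤ m := by exact_mod_cast hi
        linarith
  · intro w _ hw
    have h := congrArg (·⁻¹) (inv_Gamma_shift w (m + 1))
    simp only [inv_inv, mul_inv] at h
    rw [F, E, h, Finset.prod_range_succ, mul_inv]
    push_cast
    rw [sub_neg_eq_add, div_eq_mul_inv]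
    ring

lemma prod_neg (m : ℕ) : ∏ i ∈ Finset.range m, (-(m:ℂ) + i) = (-1) ^ m * m.factorial := by
  rw [← Finset.prod_range_reflect, ← Finset.prod_range_add_one_eq_factorial]
  push_cast
  rw [← Finset.card_range m, ← Finset.prod_const, Finset.card_range, ← Finset.prod_mul_distrib]
  refine Finset.prod_congr rfl fun i hi => ?_
  have := Finset.mem_range.1 hi
  rw [Nat.sub_sub, Nat.cast_sub (by omega)]
  push_cast
  ring

lemma E_eval {n : ℕ} (B : Fin (n + 1) → ℂ) (C : Fin n → ℂ) (m : ℕ) :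
    E B C m ((-m : ℝ) : ℂ) = (-1) ^ m / m.factorial * G B C (-m) := by
  rw [E]
  push_cast
  rw [prod_neg, neg_add_cancel_left, Gamma_one, mul_inv, ← inv_pow]
  norm_num
  ring

lemma core {n : ℕ} (B : Fin (n + 1) → ℂ) (C : Fin n → ℂ) (x : ℝ) (hx0 : 0 < x) (hx : ∀ j, x < (B j).re)
    (hδ : ∑ j, ((B j).re - (C1 C j).re) < -1) :
    Summable (fun m : ℕ => ‖(-1) ^ m / m.factorial * G B C (-m)‖) ∧
    ∫ t : ℝ, F B C (x + t * I) = 2 * Real.pi * ∑' m : ℕ, (-1) ^ m / m.factorial * G B C (-m) := by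
  have hB : ∀ j, 0 < (B j).re := fun j => hx0.trans (hx j)
  have hs : Summable (fun m : ℕ => ‖(-1) ^ m / m.factorial * G B C (-m)‖) := by
    obtain ⟨K, hK, M, h⟩ := H_far B C hB 0 le_rfl
    rw [← summable_nat_add_iff 1]
    have hsum := (Real.summable_nat_rpow.2 hδ).mul_left K
    refine Summable.of_norm_bounded_eventually_nat hsum ?_
    filter_upwards [eventually_ge_atTop 1] with N hN
    have h1 := h N 0 hN
    have e : (((-(N + 1 + 0) : ℝ) : ℂ) + ((0:ℝ):ℂ) * I) = -((N + 1 : ℕ) : ℂ) := by push_cast; ring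
    rw [e] at h1
    have hG := G_eq B C (-((N + 1 : ℕ) : ℂ)) (one_sub_ne (Or.inl (by simp; linarith [(Nat.cast_nonneg N : (0:ℝ) ≤ N)])))
    have e2 : (1 : ℂ) - -((N + 1 : ℕ) : ℂ) = ((N + 1 : ℕ) : ℂ) + 1 := by ring
    rw [e2, Gamma_nat_eq_factorial] at hG
    have hf : (((N + 1).factorial : ℕ) : ℂ) ≠ 0 := by exact_mod_cast Nat.factorial_ne_zero _
    rw [hG, norm_norm, div_mul_eq_mul_div, mul_left_comm, mul_div_cancel_left₀ _ hf, norm_mul, norm_pow]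
    simpa using h1
  refine ⟨hs, ?_⟩
  have hrec : ∀ m : ℕ, ∫ t : ℝ, F B C (x + t * I) = (∫ t : ℝ, F B C ((-(m + 1 / 2) : ℝ) + t * I))
      + 2 * Real.pi * ∑ i ∈ Finset.range (m + 1), (-1) ^ i / i.factorial * G B C (-i) := by
    intro m
    induction m with
    | zero =>
      rw [step B C 0 x hx (by simpa using hx0) (Or.inl rfl) (fun m => by
        have : (0:ℝ) ≤ m := by positivity
        linarith), E_eval]
      simp
    | succ m ih =>
      rw [ih, step B C (m + 1) (-(m + 1 / 2)) (fun j => by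
          have : (0:ℝ) ≤ m := by positivity
          linarith [hB j]) (by push_cast; linarith) (Or.inr (by push_cast; linarith)) (fun k h => by
          have h1 : (2 * m + 1 : ℝ) = 2 * k := by linarith
          have h2 : 2 * m + 1 = 2 * k := by exact_mod_cast h1
          omega), E_eval, Finset.sum_range_succ _ (m + 1)]
      ring
  have hzero : Tendsto (fun N : ℕ => ∫ t : ℝ, F B C ((-((N + 1 : ℕ) + 1 / 2) : ℝ) + t * I)) atTop (𝓝 0) := by
    obtain ⟨K, hK, h⟩ := F_far B C hB
    have hb : Tendsto (fun N : ℕ => K * (N : ℝ) ^ (∑ j, ((B j).re - (C1 C j).re)) * (2 * Real.pi)) atTop (𝓝 0) := by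
      have := (tendsto_rpow_neg_atTop (y := -(∑ j, ((B j).re - (C1 C j).re))) (by linarith)).comp tendsto_natCast_atTop_atTop
      simpa using (this.const_mul K).mul_const (2 * Real.pi)
    apply squeeze_zero_norm' _ hb
    filter_upwards [eventually_ge_atTop 1] with N hN
    rw [← integral_univ_inv_one_add_sq, ← integral_const_mul, ← integral_const_mul]
    apply norm_integral_le_of_norm_le ((integrable_inv_one_add_sq.const_mul _).const_mul _)
    refine Eventually.of_forall fun t => ?_
    have h1 := h N t hN
    push_cast at h1 ⊢
    refine h1.trans ?_
    gcongr
    exact exp_le_inv t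
  have hlim := (hs.of_norm.hasSum.tendsto_sum_nat.comp (tendsto_add_atTop_nat 2)).const_mul (2 * (Real.pi : ℂ))
  have := tendsto_nhds_unique ((hzero.add hlim).congr (fun N => (hrec (N + 1)).symm)) tendsto_const_nhds
  rw [← this, zero_add]

lemma poch_Gamma (s : ℂ) (hs : ∀ m : ℕ, s ≠ -m) (k : ℕ) :
    Complex.Gamma (s + k) = Complex.Gamma s * poch s k := by
  rw [Gamma_shift s hs k, poch, mul_comm]

lemma main {n : ℕ} (a₁ : ℂ) (b : Fin (n + 1) → ℂ) (c : Fin n → ℂ) (σ : ℝ)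
    (hσ₁ : -a₁.re < σ) (hσ₂ : ∀ j, σ < (b j).re)
    (hbal : (a₁ + (∑ j, b j) - ∑ k, c k).re < 0)
    (hc : ∀ k, ∀ m : ℕ, a₁ + c k ≠ -(m : ℂ)) :
    Summable (fun m : ℕ =>
      ‖(-1 : ℂ) ^ m / (m.factorial : ℂ) *
        ((∏ j, poch (a₁ + b j) m) / ∏ k, poch (a₁ + c k) m)‖) ∧
    (1 / (2 * (Real.pi : ℂ))) *
      (∫ t : ℝ,
        let z : ℂ := (σ : ℂ) + (t : ℂ) * Complex.I
        (Γ (a₁ + z) * ∏ j, Γ (b j - z)) / ∏ k, Γ (c k - z)) =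
      ((∏ j, Γ (a₁ + b j)) / ∏ k, Γ (a₁ + c k)) *
        ∑' m : ℕ, (-1 : ℂ) ^ m / (m.factorial : ℂ) *
          ((∏ j, poch (a₁ + b j) m) / ∏ k, poch (a₁ + c k) m) := by
  set B : Fin (n + 1) → ℂ := fun j => a₁ + b j with hBdef
  set C : Fin n → ℂ := fun k => a₁ + c k with hCdef
  have hx : ∀ j, a₁.re + σ < (B j).re := fun j => by simp [hBdef, hσ₂ j]
  have hBpos : ∀ j, 0 < (B j).re := fun j => by linarith [hx j]
  have hδ : ∑ j, ((B j).re - (C1 C j).re) < -1 := by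
    rw [Finset.sum_sub_distrib, Fin.sum_univ_succ (fun j => (C1 C j).re)]
    simp only [C1, Fin.cons_zero, Fin.cons_succ, hBdef, hCdef, add_re, one_re, Finset.sum_add_distrib,
      Finset.sum_const, Finset.card_univ, Fintype.card_fin, nsmul_eq_mul]
    simp only [sub_re, add_re, re_sum] at hbal
    push_cast
    linarith
  obtain ⟨hs, hint⟩ := core B C (a₁.re + σ) (by linarith) hx hδ
  set P : ℂ := (∏ j, Γ (a₁ + b j)) / ∏ k, Γ (a₁ + c k) with hP
  have hP0 : P ≠ 0 := by
    apply div_ne_zero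
    · exact Finset.prod_ne_zero_iff.2 fun j _ => Gamma_ne_zero_of_re_pos (hBpos j)
    · exact Finset.prod_ne_zero_iff.2 fun k _ => Gamma_ne_zero (hc k)
  have hG : ∀ m : ℕ, G B C (-m) = P * ((∏ j, poch (a₁ + b j) m) / ∏ k, poch (a₁ + c k) m) := by
    intro m
    rw [G, hP]
    simp only [sub_neg_eq_add]
    have h1 : ∀ j, Complex.Gamma (B j + m) = Complex.Gamma (a₁ + b j) * poch (a₁ + b j) m := by
      intro j
      apply poch_Gamma
      intro k h
      have h1 := congrArg Complex.re h
      have h2 := hBpos j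
      simp only [hBdef] at h2
      rw [h1] at h2
      simp at h2
      have : (0:ℝ) ≤ k := by positivity
      linarith
    have h2 : ∀ j, Complex.Gamma (C j + m) = Complex.Gamma (a₁ + c j) * poch (a₁ + c j) m :=
      fun j => poch_Gamma _ (hc j) m
    simp only [h1, h2, Finset.prod_mul_distrib]
    rw [mul_div_mul_comm]
  have hterm : ∀ m : ℕ, (-1 : ℂ) ^ m / (m.factorial : ℂ) * G B C (-m) =
      P * ((-1 : ℂ) ^ m / (m.factorial : ℂ) * ((∏ j, poch (a₁ + b j) m) / ∏ k, poch (a₁ + c k) m)) := by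
    intro m; rw [hG]; ring
  simp_rw [hterm] at hs hint
  constructor
  · simp_rw [norm_mul P] at hs
    exact (summable_mul_left_iff (norm_ne_zero_iff.2 hP0)).1 hs
  · rw [tsum_mul_left] at hint
    have he : (∫ t : ℝ,
        let z : ℂ := (σ : ℂ) + (t : ℂ) * Complex.I
        (Γ (a₁ + z) * ∏ j, Γ (b j - z)) / ∏ k, Γ (c k - z))
        = ∫ t : ℝ, F B C ((a₁.re + σ : ℝ) + t * I) := by
      rw [← integral_add_right_eq_self (fun t : ℝ => F B C ((a₁.re + σ : ℝ) + t * I)) a₁.im]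
      congr 1; ext t
      have ew : (((a₁.re + σ : ℝ) : ℂ) + ((t + a₁.im : ℝ) : ℂ) * I) = a₁ + (σ + t * I) := by
        conv_rhs => rw [← re_add_im a₁]
        push_cast; ring
      simp only [F, G]
      rw [ew, mul_div_assoc]
      simp only [hBdef, hCdef, add_sub_add_left_eq_sub]
    rw [he, hint]
    have : (Real.pi : ℂ) ≠ 0 := by exact_mod_cast Real.pi_ne_zero
    field_simp

end MBR

/-- Resummation of a Mellin–Barnes integral with a single family of left poles into a
generalized hypergeometric series `ₙF_{n−1}` at argument `−1` (the paper's eq. (C.4)):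
closing the contour to the left and summing the residues of the unique left family
`Γ(a₁+z)` resums the integral into an absolutely convergent series. -/
theorem mellin_barnes_resummation
    (n : ℕ) (hn : 2 ≤ n) (a₁ : ℂ) (b : Fin n → ℂ) (c : Fin (n - 1) → ℂ) (σ : ℝ)
    (hσ₁ : -a₁.re < σ) (hσ₂ : ∀ j, σ < (b j).re)
    (hbal : (a₁ + (∑ j, b j) - ∑ k, c k).re < 0)
    (hc : ∀ k, ∀ m : ℕ, a₁ + c k ≠ -(m : ℂ)) :
    Summable (fun m : ℕ =>
      ‖(-1 : ℂ) ^ m / (m.factorial : ℂ) *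
        ((∏ j, poch (a₁ + b j) m) / ∏ k, poch (a₁ + c k) m)‖) ∧
    (1 / (2 * (Real.pi : ℂ))) *
      (∫ t : ℝ,
        let z : ℂ := (σ : ℂ) + (t : ℂ) * Complex.I
        (Γ (a₁ + z) * ∏ j, Γ (b j - z)) / ∏ k, Γ (c k - z)) =
      ((∏ j, Γ (a₁ + b j)) / ∏ k, Γ (a₁ + c k)) *
        ∑' m : ℕ, (-1 : ℂ) ^ m / (m.factorial : ℂ) *
          ((∏ j, poch (a₁ + b j) m) / ∏ k, poch (a₁ + c k) m) := by
  obtain ⟨k, rfl⟩ : ∃ k, n = k + 1 := ⟨n - 1, by omega⟩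
  exact MBR.main a₁ b c σ hσ₁ hσ₂ hbal hc
end

section
/- Concentration of the Mellin–Barnes kernel used in the loop-formation construction: let f : ℝ → ℂ be a bounded continuous function. Then lim_{ε→0⁺} (1/Γ(ε)) · (1/(2π)) ∫_ℝ Γ(ε/2 + i·t)·Γ(ε/2 − i·t)·f(t) dt = f(0); that is, the positive kernels t ↦ Γ(ε/2+it)Γ(ε/2−it)/(2π·Γ(ε)) = |Γ(ε/2+it)|²/(2π·Γ(ε)) concentrate at t = 0 with total mass tending to 1 as ε → 0⁺ (here ε ranges over positive reals). -/
open MeasureTheory Filter Topology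

local notation "Γ" => Complex.Gamma

lemma mkc_norm_Gamma_le (s : ℂ) (hs : 0 < s.re) : ‖Γ s‖ ≤ Real.Gamma s.re := by
  rw [Complex.Gamma_eq_integral hs, Real.Gamma_eq_integral hs, Complex.GammaIntegral]
  refine (norm_integral_le_integral_norm _).trans (le_of_eq ?_)
  refine setIntegral_congr_fun measurableSet_Ioi ?_
  intro x hx
  have hx' : (0 : ℝ) < x := hx
  simp only [norm_mul, Complex.norm_real, Real.norm_eq_abs, Real.abs_exp]
  rw [Complex.norm_cpow_eq_rpow_re_of_pos hx']
  simp

lemma mkc_contAt (s : ℂ) (hs : 0 < s.re) : ContinuousAt Γ s := by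
  refine (Complex.differentiableAt_Gamma s ?_).continuousAt
  intro m h
  rw [h] at hs
  simp at hs
  have : (0 : ℝ) ≤ m := Nat.cast_nonneg m
  linarith

lemma mkc_rewrite (f : ℝ → ℂ) (ε : ℝ) (hε : 0 < ε) :
    (Γ (ε : ℂ))⁻¹ *
          ((1 / (2 * (Real.pi : ℂ))) *
            ∫ t : ℝ,
              Γ ((ε : ℂ) / 2 + (t : ℂ) * Complex.I) *
                Γ ((ε : ℂ) / 2 - (t : ℂ) * Complex.I) * f t) =
    (Γ ((ε : ℂ) + 1))⁻¹ * ((1 / (Real.pi : ℂ)) *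
      ∫ s : ℝ, (((1 + s ^ 2)⁻¹ : ℝ) : ℂ) *
        (Γ ((ε : ℂ) / 2 + ((ε / 2 * s : ℝ) : ℂ) * Complex.I + 1) *
         Γ ((ε : ℂ) / 2 - ((ε / 2 * s : ℝ) : ℂ) * Complex.I + 1) * f (ε / 2 * s))) := by
  have hε0 : (ε : ℂ) ≠ 0 := by exact_mod_cast hε.ne'
  have hcv := Measure.integral_comp_mul_left (fun t : ℝ =>
              Γ ((ε : ℂ) / 2 + (t : ℂ) * Complex.I) *
                Γ ((ε : ℂ) / 2 - (t : ℂ) * Complex.I) * f t) (ε / 2)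
  have h2 : ∀ s : ℝ, (((1 + s ^ 2)⁻¹ : ℝ) : ℂ) *
        (Γ ((ε : ℂ) / 2 + ((ε / 2 * s : ℝ) : ℂ) * Complex.I + 1) *
         Γ ((ε : ℂ) / 2 - ((ε / 2 * s : ℝ) : ℂ) * Complex.I + 1) * f (ε / 2 * s)) =
      ((ε : ℂ) ^ 2 / 4) * (Γ ((ε : ℂ) / 2 + ((ε / 2 * s : ℝ) : ℂ) * Complex.I) *
         Γ ((ε : ℂ) / 2 - ((ε / 2 * s : ℝ) : ℂ) * Complex.I) * f (ε / 2 * s)) := by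
    intro s
    have hp : ((1 : ℂ) + (s : ℂ) ^ 2) ≠ 0 := by
      have : (1 + s ^ 2 : ℝ) ≠ 0 := by positivity
      exact_mod_cast this
    rw [Complex.Gamma_add_one, Complex.Gamma_add_one]
    · have hI : ((ε : ℂ) / 2 + ((ε / 2 * s : ℝ) : ℂ) * Complex.I) *
          ((ε : ℂ) / 2 - ((ε / 2 * s : ℝ) : ℂ) * Complex.I) =
          (ε : ℂ) ^ 2 / 4 * (1 + (s : ℂ) ^ 2) := by
        push_cast
        linear_combination (-(ε : ℂ) ^ 2 / 4 * (s : ℂ) ^ 2) * Complex.I_sq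
      have hinv : (((1 + s ^ 2)⁻¹ : ℝ) : ℂ) * (1 + (s : ℂ) ^ 2) = 1 := by
        push_cast
        exact inv_mul_cancel₀ hp
      generalize Γ ((ε : ℂ) / 2 + ((ε / 2 * s : ℝ) : ℂ) * Complex.I) = A
      generalize Γ ((ε : ℂ) / 2 - ((ε / 2 * s : ℝ) : ℂ) * Complex.I) = B
      linear_combination ((((1 + s ^ 2)⁻¹ : ℝ) : ℂ) * A * B * f (ε / 2 * s)) * hI +
        ((ε : ℂ) ^ 2 / 4 * A * B * f (ε / 2 * s)) * hinv
    · intro h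
      have := congrArg Complex.re h
      simp at this
      exact hε.ne' this
    · intro h
      have := congrArg Complex.re h
      simp at this
      exact hε.ne' this
  simp_rw [h2]
  rw [integral_const_mul, hcv, Complex.Gamma_add_one _ hε0, abs_of_pos (by positivity),
    Complex.real_smul]
  generalize (∫ t : ℝ, Γ ((ε : ℂ) / 2 + (t : ℂ) * Complex.I) *
                Γ ((ε : ℂ) / 2 - (t : ℂ) * Complex.I) * f t) = J
  push_cast
  rw [mul_inv]
  field_simp
  ring

/-- Concentration of the Mellin–Barnes kernel used in the loop-formation construction
(the paper's Section 2.2, eqs. (2.11)–(2.13)): for any bounded continuous `f : ℝ → ℂ`,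
the positive kernels `t ↦ Γ(ε/2+it)Γ(ε/2−it)/(2π Γ(ε))` concentrate at `t = 0` with total
mass tending to `1` as `ε → 0⁺`, so the regulated Mellin integral localizes at `t = 0`. -/
theorem mellin_kernel_concentration
    (f : ℝ → ℂ) (hf : Continuous f) (hbd : ∃ M : ℝ, ∀ t : ℝ, ‖f t‖ ≤ M) :
    Tendsto
      (fun ε : ℝ =>
        (Γ (ε : ℂ))⁻¹ *
          ((1 / (2 * (Real.pi : ℂ))) *
            ∫ t : ℝ,
              Γ ((ε : ℂ) / 2 + (t : ℂ) * Complex.I) *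
                Γ ((ε : ℂ) / 2 - (t : ℂ) * Complex.I) * f t))
      (𝓝[>] (0 : ℝ)) (𝓝 (f 0)) := by
  obtain ⟨M, hM⟩ := hbd
  have hpos : ∀ᶠ ε : ℝ in 𝓝[>] (0 : ℝ), 0 < ε := self_mem_nhdsWithin
  refine Tendsto.congr' (hpos.mono fun ε hε => (mkc_rewrite f ε hε).symm) ?_
  have hG1 : Tendsto (fun ε : ℝ => (Γ ((ε : ℂ) + 1))⁻¹) (𝓝[>] (0 : ℝ)) (𝓝 1) := by
    have : ContinuousAt (fun ε : ℝ => (Γ ((ε : ℂ) + 1))⁻¹) 0 := by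
      refine ContinuousAt.inv₀ ?_ (by simp)
      refine ContinuousAt.comp (g := Γ) (mkc_contAt _ (by simp)) ?_
      fun_prop
    simpa using this.tendsto.mono_left nhdsWithin_le_nhds
  have hR : ∀ᶠ ε : ℝ in 𝓝[>] (0 : ℝ), Real.Gamma (ε / 2 + 1) ≤ 2 := by
    have hc : ContinuousAt (fun ε : ℝ => Real.Gamma (ε / 2 + 1)) 0 := by
      refine ContinuousAt.comp (g := Real.Gamma) ?_ (by fun_prop)
      refine (Real.differentiableAt_Gamma ?_).continuousAt
      intro m h
      have : (0 : ℝ) ≤ m := Nat.cast_nonneg m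
      norm_num at h
      linarith
    have ht := hc.tendsto.mono_left (nhdsWithin_le_nhds (s := Set.Ioi 0))
    exact ht.eventually_le_const (by simp)
  have hint : Tendsto (fun ε : ℝ => ∫ s : ℝ, (((1 + s ^ 2)⁻¹ : ℝ) : ℂ) *
        (Γ ((ε : ℂ) / 2 + ((ε / 2 * s : ℝ) : ℂ) * Complex.I + 1) *
         Γ ((ε : ℂ) / 2 - ((ε / 2 * s : ℝ) : ℂ) * Complex.I + 1) * f (ε / 2 * s)))
      (𝓝[>] (0 : ℝ)) (𝓝 (∫ s : ℝ, (((1 + s ^ 2)⁻¹ : ℝ) : ℂ) * f 0)) := by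
    refine tendsto_integral_filter_of_dominated_convergence
      (fun s => (1 + s ^ 2)⁻¹ * (2 * 2 * M)) ?_ ?_ ?_ ?_
    · filter_upwards [hpos] with ε hε
      refine Continuous.aestronglyMeasurable ?_
      refine Continuous.mul ?_ (Continuous.mul (Continuous.mul ?_ ?_) (by fun_prop))
      · refine Complex.continuous_ofReal.comp (Continuous.inv₀ (by fun_prop) ?_)
        intro s
        positivity
      · refine continuous_iff_continuousAt.2 fun s => ?_
        refine ContinuousAt.comp (g := Γ) (mkc_contAt _ ?_) (by fun_prop)
        simp
        linarith
      · refine continuous_iff_continuousAt.2 fun s => ?_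
        refine ContinuousAt.comp (g := Γ) (mkc_contAt _ ?_) (by fun_prop)
        simp
        linarith
    · filter_upwards [hpos, hR] with ε hε hR
      refine Eventually.of_forall fun s => ?_
      have hp : (0 : ℝ) ≤ (1 + s ^ 2)⁻¹ := by positivity
      rw [norm_mul, norm_mul, norm_mul, Complex.norm_real, Real.norm_of_nonneg hp]
      have h1 : ‖Γ ((ε : ℂ) / 2 + ((ε / 2 * s : ℝ) : ℂ) * Complex.I + 1)‖ ≤ 2 := by
        have hre : ((ε : ℂ) / 2 + ((ε / 2 * s : ℝ) : ℂ) * Complex.I + 1).re = ε / 2 + 1 := by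
          simp
        refine (mkc_norm_Gamma_le _ (by rw [hre]; linarith)).trans ?_
        rw [hre]
        exact hR
      have h2 : ‖Γ ((ε : ℂ) / 2 - ((ε / 2 * s : ℝ) : ℂ) * Complex.I + 1)‖ ≤ 2 := by
        have hre : ((ε : ℂ) / 2 - ((ε / 2 * s : ℝ) : ℂ) * Complex.I + 1).re = ε / 2 + 1 := by
          simp
        refine (mkc_norm_Gamma_le _ (by rw [hre]; linarith)).trans ?_
        rw [hre]
        exact hR
      have h3 := hM (ε / 2 * s)
      gcongr
    · exact integrable_inv_one_add_sq.mul_const _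
    · refine Eventually.of_forall fun s => ?_
      have hc : ContinuousAt (fun ε : ℝ => (((1 + s ^ 2)⁻¹ : ℝ) : ℂ) *
        (Γ ((ε : ℂ) / 2 + ((ε / 2 * s : ℝ) : ℂ) * Complex.I + 1) *
         Γ ((ε : ℂ) / 2 - ((ε / 2 * s : ℝ) : ℂ) * Complex.I + 1) * f (ε / 2 * s))) 0 := by
        refine continuousAt_const.mul (ContinuousAt.mul (ContinuousAt.mul ?_ ?_) (by fun_prop))
        · exact ContinuousAt.comp (g := Γ) (mkc_contAt _ (by simp)) (by fun_prop)
        · exact ContinuousAt.comp (g := Γ) (mkc_contAt _ (by simp)) (by fun_prop)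
      have := hc.tendsto.mono_left (nhdsWithin_le_nhds (s := Set.Ioi 0))
      simpa using this
  have hval : (∫ s : ℝ, (((1 + s ^ 2)⁻¹ : ℝ) : ℂ) * f 0) = (Real.pi : ℂ) * f 0 := by
    rw [integral_mul_const, integral_complex_ofReal, integral_univ_inv_one_add_sq]
  rw [hval] at hint
  have hpi : (Real.pi : ℂ) ≠ 0 := by exact_mod_cast Real.pi_ne_zero
  have := hG1.mul (hint.const_mul (1 / (Real.pi : ℂ)))
  convert this using 2
  field_simp
end
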